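/- arXiv:1608.06981 — 12 statements merged into one kernel-verified Lean document; each statement's English description precedes it below -/
import Mathlib

section
/- Let n < ω and let D_i (i < n) be digraphs on vertex sets V_i such that there is a single set R with V_i ∩ V_j = R for all i < j < n, and for all i < j < n there is a digraph isomorphism ψ_{i,j} : D_i → D_j which is the identity on R. Then D = ⋃_{i<n} D_i is a digraph, and for every integer k ≥ 3, if each D_i has digirth greater than k, then every directed path in D with at least one arc from a vertex α ∈ V_i to the vertex ψ_{i,j}(α) ∈ V_j (for i < j < n) has length greater than k. -/
/-- A digraph on a vertex set `verts`: arcs go between vertices of `verts`,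
there are no loops and no pair of opposite arcs. -/
structure Digraph' (V : Type*) where
  verts : Set V
  Arc : V → V → Prop
  arc_left : ∀ ⦃u v : V⦄, Arc u v → u ∈ verts
  arc_right : ∀ ⦃u v : V⦄, Arc u v → v ∈ verts
  irrefl' : ∀ v : V, ¬ Arc v v
  asymm' : ∀ u v : V, Arc u v → ¬ Arc v u

namespace Digraph'

variable {V : Type*} {W : Type*}

/-- A directed cycle of length `m` (with `m ≥ 1`) with respect to the arc relation `E`,
all of whose vertices lie in `A`. -/
def RelDicycle (E : V → V → Prop) (A : Set V) (m : ℕ) (c : ZMod m → V) : Prop :=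
  1 ≤ m ∧ Function.Injective c ∧ (∀ i, c i ∈ A) ∧ ∀ i, E (c i) (c (i + 1))

/-- The arc relation `E` has no directed cycle of length `≤ k`, i.e. digirth `> k`. -/
def RelDigirthGT (E : V → V → Prop) (k : ℕ) : Prop :=
  ∀ m ≤ k, ∀ c : ZMod m → V, ¬ RelDicycle E Set.univ m c

/-- A directed cycle of length `m` in the digraph `D`, all of whose vertices lie in `A`. -/
def DicycleIn (D : Digraph' V) (A : Set V) (m : ℕ) (c : ZMod m → V) : Prop :=
  RelDicycle D.Arc A m c

/-- The digraph `D` has digirth `> k`. -/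
def DigirthGT (D : Digraph' V) (k : ℕ) : Prop :=
  RelDigirthGT D.Arc k

/-- `A` is an acyclic set of vertices of `D`: the subdigraph induced on `A`
contains no directed cycle. -/
def AcyclicSet (D : Digraph' V) (A : Set V) : Prop :=
  ∀ m c, ¬ D.DicycleIn A m c

/-- `D` has uncountable dichromatic number: its vertex set cannot be covered by
countably many acyclic sets. -/
def UncountableDichromatic (D : Digraph' V) : Prop :=
  ¬ ∃ F : ℕ → Set V, (∀ n, D.AcyclicSet (F n)) ∧ D.verts ⊆ ⋃ n, F n

/-- The dichromatic number of `D` is at most `μ`: the vertex set can be covered by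
at most `μ` many acyclic sets. -/
def DichromaticLE (D : Digraph' V) (μ : Cardinal) : Prop :=
  ∃ 𝒜 : Set (Set V), Cardinal.mk 𝒜 ≤ μ ∧ (∀ A ∈ 𝒜, D.AcyclicSet A) ∧ D.verts ⊆ ⋃₀ 𝒜

/-- The subdigraph of `D` induced on the set `A`. -/
def induce (D : Digraph' V) (A : Set V) : Digraph' V where
  verts := D.verts ∩ A
  Arc u v := D.Arc u v ∧ u ∈ A ∧ v ∈ A
  arc_left := fun _ _ h => ⟨D.arc_left h.1, h.2.1⟩
  arc_right := fun _ _ h => ⟨D.arc_right h.1, h.2.2⟩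
  irrefl' := fun v h => D.irrefl' v h.1
  asymm' := fun u v h h' => D.asymm' u v h.1 h'.1

/-- `D₀` embeds into `D`: an injective map of the vertices carrying arcs to arcs
(the copy need not be induced). -/
def Embeds (D₀ : Digraph' W) (D : Digraph' V) : Prop :=
  ∃ f : W → V, Set.InjOn f D₀.verts ∧ Set.MapsTo f D₀.verts D.verts ∧
    ∀ ⦃u v : W⦄, D₀.Arc u v → D.Arc (f u) (f v)

/-- The reverse of a digraph: all arcs are reversed. -/
def rev (D : Digraph' V) : Digraph' V where
  verts := D.verts
  Arc u v := D.Arc v u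
  arc_left := fun _ _ h => D.arc_right h
  arc_right := fun _ _ h => D.arc_left h
  irrefl' := fun v h => D.irrefl' v h
  asymm' := fun u v h h' => D.asymm' v u h h'

end Digraph'

/-- A closed walk of positive length contains a directed cycle which is no longer. -/
theorem Digraph'.RelDigirthGT.lt_of_closed_walk {V : Type*} {E : V → V → Prop} {k l : ℕ}
    (hE : Digraph'.RelDigirthGT E k) (w : ℕ → V) (hl : 1 ≤ l)
    (hw : ∀ m < l, E (w m) (w (m + 1))) (hclosed : w 0 = w l) : k < l := by
  classical
  have hex : ∃ d, 1 ≤ d ∧ ∃ s, s + d ≤ l ∧ w s = w (s + d) :=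
    ⟨l, hl, 0, by simp, by simpa using hclosed⟩
  obtain ⟨hd, s, hsl, hs⟩ := Nat.find_spec hex
  have hmin := fun m (hm : m < Nat.find hex) => Nat.find_min hex hm
  generalize Nat.find hex = d at hd hsl hs hmin
  have : NeZero d := ⟨by omega⟩
  by_contra! hlk
  have hne : ∀ a b : ℕ, a < b → b < d → w (s + a) ≠ w (s + b) := fun a b hab hb h =>
    hmin (b - a) (by omega) ⟨by omega, s + a, by omega, by
      rw [h]; congr 1; omega⟩
  refine hE d (by omega) (fun x => w (s + x.val)) ⟨hd, ?_, fun _ => Set.mem_univ _, ?_⟩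
  · intro x y hxy
    apply ZMod.val_injective d
    have hx := x.val_lt
    have hy := y.val_lt
    rcases lt_trichotomy x.val y.val with h | h | h
    · exact absurd hxy (hne _ _ h hy)
    · exact h
    · exact absurd hxy.symm (hne _ _ h hx)
  · intro x
    have hx := x.val_lt
    have harc := hw (s + x.val) (by omega)
    have hval : (x + 1).val = (x.val + 1) % d := by
      rw [ZMod.val_add, ZMod.val_one_eq_one_mod, Nat.add_mod_mod]
    rcases Nat.lt_or_ge (x.val + 1) d with h | h
    · simpa only [hval, Nat.mod_eq_of_lt h, add_assoc] using harc
    · have heq : x.val + 1 = d := by omega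
      simp only [hval, heq, Nat.mod_self, add_zero]
      rwa [add_assoc, heq, ← hs] at harc

/-- Maps on the pieces of a cover which agree on overlaps glue to a map on the whole type. -/
theorem exists_glue_of_agree {ι V W : Type*} [Nonempty W] (S : ι → Set V) (q : ι → V → W)
    (hq : ∀ i j x, x ∈ S i → x ∈ S j → q i x = q j x) :
    ∃ f : V → W, ∀ i, ∀ x ∈ S i, f x = q i x := by
  classical
  refine ⟨fun x => if h : ∃ i, x ∈ S i then q h.choose x else Classical.arbitrary W, ?_⟩
  intro i x hx
  have h : ∃ i, x ∈ S i := ⟨i, hx⟩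
  simp only [dif_pos h]
  exact hq _ _ _ h.choose_spec hx

/-- Amalgamation lemma, part (1): the union of the `Dᵢ` is a digraph, and any directed
path with at least one arc from a vertex `a ∈ Vᵢ` to `ψ i j a ∈ Vⱼ` has length `> k`. -/
theorem statement_0 {V : Type*} (n : ℕ) (D : Fin n → Digraph' V) (R : Set V)
    (ψ : Fin n → Fin n → V → V)
    (hR : ∀ i j : Fin n, i < j → (D i).verts ∩ (D j).verts = R)
    (hbij : ∀ i j : Fin n, i < j → Set.BijOn (ψ i j) (D i).verts (D j).verts)
    (hid : ∀ i j : Fin n, i < j → ∀ x ∈ R, ψ i j x = x)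
    (hiso : ∀ i j : Fin n, i < j → ∀ u v : V, u ∈ (D i).verts → v ∈ (D i).verts →
      ((D i).Arc u v ↔ (D j).Arc (ψ i j u) (ψ i j v))) :
    -- `D = ⋃ i, D i` is a digraph (no loops and no pair of opposite arcs):
    ((∀ v : V, ¬ ∃ i : Fin n, (D i).Arc v v) ∧
      (∀ u v : V, (∃ i : Fin n, (D i).Arc u v) → ¬ ∃ j : Fin n, (D j).Arc v u)) ∧
    -- and the path statement:
    (∀ k : ℕ, 3 ≤ k → (∀ i : Fin n, (D i).DigirthGT k) →
      ∀ i j : Fin n, i < j → ∀ a ∈ (D i).verts,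
        ∀ (ℓ : ℕ) (p : Fin (ℓ + 1) → V), 1 ≤ ℓ → Function.Injective p →
          (∀ m : Fin ℓ, ∃ i' : Fin n, (D i').Arc (p m.castSucc) (p m.succ)) →
          p 0 = a → p (Fin.last ℓ) = ψ i j a → k < ℓ) := by
  have hmeet : ∀ {i j : Fin n}, i ≠ j → ∀ {x}, x ∈ (D i).verts → x ∈ (D j).verts → x ∈ R := by
    intro i j hij x hi hj
    rcases lt_or_gt_of_ne hij with h | h
    · exact hR i j h ▸ ⟨hi, hj⟩
    · exact hR j i h ▸ ⟨hj, hi⟩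
  refine ⟨⟨fun v ⟨i, hi⟩ => (D i).irrefl' v hi, ?_⟩, ?_⟩
  · rintro u v ⟨i, hi⟩ ⟨j, hj⟩
    have hui := (D i).arc_left hi
    have hvi := (D i).arc_right hi
    have huj := (D j).arc_right hj
    have hvj := (D j).arc_left hj
    rcases lt_trichotomy i j with h | rfl | h
    · have harc := (hiso i j h u v hui hvi).1 hi
      rw [hid i j h u (hmeet h.ne hui huj), hid i j h v (hmeet h.ne hvi hvj)] at harc
      exact (D j).asymm' _ _ harc hj
    · exact (D i).asymm' _ _ hi hj
    · have harc := (hiso j i h v u hvj huj).1 hj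
      rw [hid j i h u (hmeet h.ne huj hui), hid j i h v (hmeet h.ne hvj hvi)] at harc
      exact (D i).asymm' _ _ hi harc
  · intro k _ hgirth i j hij a ha l p hl _ hp hp0 hpl
    have : Nonempty V := ⟨a⟩
    have hRi : R ⊆ (D i).verts := by
      rw [← hR i j hij]; exact Set.inter_subset_left
    -- retract every `D m` onto `D i`, fixing `R`
    have hretract : ∀ m : Fin n, ∃ q : V → V, (∀ x ∈ R, q x = x) ∧
        (∀ u v, (D m).Arc u v → (D i).Arc (q u) (q v)) ∧
        (m = i → ∀ x, q x = x) ∧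
        (i < m → ∀ x ∈ (D i).verts, q (ψ i m x) = x) := by
      intro m
      rcases lt_trichotomy i m with h | rfl | h
      · have hleft := (hbij i m h).injOn.leftInvOn_invFunOn
        refine ⟨Function.invFunOn (ψ i m) (D i).verts, ?_, ?_, ?_, fun _ => hleft⟩
        · intro x hx
          have := hleft (hRi hx)
          rwa [hid i m h x hx] at this
        · intro u v huv
          obtain ⟨u, hu, rfl⟩ := (hbij i m h).surjOn ((D m).arc_left huv)
          obtain ⟨v, hv, rfl⟩ := (hbij i m h).surjOn ((D m).arc_right huv)
          rw [hleft hu, hleft hv]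
          exact (hiso i m h u v hu hv).2 huv
        · exact fun he => absurd he h.ne'
      · exact ⟨id, fun _ _ => rfl, fun _ _ h => h, fun _ _ => rfl, fun h => absurd h (lt_irrefl _)⟩
      · exact ⟨ψ m i, hid m i h,
          fun u v huv => (hiso m i h u v ((D m).arc_left huv) ((D m).arc_right huv)).1 huv,
          fun he => absurd he h.ne, fun h' => absurd h' h.asymm⟩
    choose q hqR hqArc hqi hqψ using hretract
    obtain ⟨f, hf⟩ := exists_glue_of_agree (fun m => (D m).verts) q (by
      intro m m' x hm hm'
      by_cases he : m = m'
      · rw [he]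
      · have hx := hmeet he hm hm'
        rw [hqR m x hx, hqR m' x hx])
    refine Digraph'.RelDigirthGT.lt_of_closed_walk (hgirth i) (fun m => f (p (Fin.ofNat (l + 1) m))) hl ?_ ?_
    · intro m hm
      obtain ⟨i', hi'⟩ := hp ⟨m, hm⟩
      have h1 : Fin.ofNat (l + 1) m = (⟨m, hm⟩ : Fin l).castSucc :=
        Fin.ext (Nat.mod_eq_of_lt (by omega))
      have h2 : Fin.ofNat (l + 1) (m + 1) = (⟨m, hm⟩ : Fin l).succ :=
        Fin.ext (Nat.mod_eq_of_lt (by omega))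
      simp only [h1, h2]
      rw [hf i' _ ((D i').arc_left hi'), hf i' _ ((D i').arc_right hi')]
      exact hqArc i' _ _ hi'
    · have h1 : Fin.ofNat (l + 1) 0 = 0 := rfl
      have h2 : Fin.ofNat (l + 1) l = Fin.last l := Fin.ext (Nat.mod_eq_of_lt (by omega))
      simp only [h1, h2, hp0, hpl]
      rw [hf i a ha, hf j _ ((hbij i j hij).mapsTo ha), hqi i rfl, hqψ j hij a ha]
end

section
/- Let n < ω and let D_i (i < n) be digraphs on vertex sets V_i such that there is a single set R with V_i ∩ V_j = R for all i < j < n, and for all i < j < n there is a digraph isomorphism ψ_{i,j} : D_i → D_j which is the identity on R. Fix an integer k ≥ 3. If each D_i has digirth greater than k, then the digraph D = ⋃_{i<n} D_i has digirth greater than k. -/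
namespace Digraph'

variable {V : Type*}

/-- A closed walk of length `m` contains a directed cycle of length at most `m`. -/
theorem exists_relDicycle_of_closed_walk {E : V → V → Prop} {m : ℕ} (hm : 1 ≤ m)
    (w : ℕ → V) (hw : w m = w 0) (hE : ∀ i, E (w i) (w (i + 1))) :
    ∃ d ≤ m, ∃ c : ZMod d → V, RelDicycle E Set.univ d c := by
  classical
  have hex : ∃ d, 1 ≤ d ∧ ∃ a, w (a + d) = w a := ⟨m, hm, 0, by simpa using hw⟩
  obtain ⟨hd, a, ha⟩ := Nat.find_spec hex
  have hmin : ∀ e < Nat.find hex, 1 ≤ e → ∀ b, w (b + e) ≠ w b :=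
    fun e he h1 b hb => Nat.find_min hex he ⟨h1, b, hb⟩
  have hle : Nat.find hex ≤ m := Nat.find_min' hex ⟨hm, 0, by simpa using hw⟩
  generalize Nat.find hex = d at hd ha hmin hle
  have : NeZero d := ⟨by omega⟩
  have hne : ∀ i j : ℕ, i < j → j < d → w (a + i) ≠ w (a + j) := fun i j hij hj h =>
    hmin (j - i) (by omega) (by omega) (a + i) (by rw [h]; congr 1; omega)
  refine ⟨d, hle, fun i => w (a + i.val), hd, fun i j hij => ?_, fun _ => trivial, fun i => ?_⟩
  · apply ZMod.val_injective d
    rcases lt_trichotomy i.val j.val with h | h | h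
    · exact absurd hij (hne _ _ h j.val_lt)
    · exact h
    · exact absurd hij.symm (hne _ _ h i.val_lt)
  · have hstep := hE (a + i.val)
    have hi := i.val_lt
    have hval : (i + 1).val = (i.val + 1) % d := by
      rw [ZMod.val_add, ZMod.val_one_eq_one_mod, Nat.add_mod_mod]
    dsimp only
    rw [hval]
    rcases Nat.lt_or_ge (i.val + 1) d with h | h
    · rwa [Nat.mod_eq_of_lt h]
    · have hlast : i.val + 1 = d := by omega
      rw [add_assoc, hlast, ha] at hstep
      rwa [hlast, Nat.mod_self]

/-- A relation that maps homomorphically to one of digirth `> k` has digirth `> k`. -/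
theorem RelDigirthGT.of_hom {W : Type*} {E : V → V → Prop} {F : W → W → Prop} {k : ℕ}
    (hF : RelDigirthGT F k) (f : V → W) (hf : ∀ u v, E u v → F (f u) (f v)) :
    RelDigirthGT E k := by
  rintro m hmk c ⟨hm, -, -, hc⟩
  obtain ⟨d, hd, e, he⟩ := exists_relDicycle_of_closed_walk (E := F) hm
    (fun i => f (c (i : ZMod m))) (by simp)
    (fun i => by simpa using hf _ _ (hc (i : ZMod m)))
  exact hF d (hd.trans hmk) e he

/-- Compatible homomorphisms on the members of a family of digraphs glue to a
homomorphism on their union. -/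
theorem exists_hom_union {ι W : Type*} [Nonempty W] {F : W → W → Prop} (D : ι → Digraph' V) (g : ι → V → W)
    (hg : ∀ i u v, (D i).Arc u v → F (g i u) (g i v))
    (hcompat : ∀ i j x, x ∈ (D i).verts → x ∈ (D j).verts → g i x = g j x) :
    ∃ f : V → W, ∀ u v, (∃ i, (D i).Arc u v) → F (f u) (f v) := by
  classical
  let f : V → W := fun x =>
    if h : ∃ i, x ∈ (D i).verts then g h.choose x else Classical.arbitrary W
  have hf : ∀ i x, x ∈ (D i).verts → f x = g i x := fun i x hx => by
    have h : ∃ i, x ∈ (D i).verts := ⟨i, hx⟩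
    simp only [f, dif_pos h]
    exact hcompat _ _ _ h.choose_spec hx
  refine ⟨f, fun u v ⟨i, h⟩ => ?_⟩
  rw [hf i u ((D i).arc_left h), hf i v ((D i).arc_right h)]
  exact hg i u v h

end Digraph'

/-- Amalgamation lemma, part (2): if each `Dᵢ` has digirth `> k` (where `k ≥ 3`),
then the union digraph `D = ⋃ i, D i` has digirth `> k`. -/
theorem statement_1 {V : Type*} (n : ℕ) (D : Fin n → Digraph' V) (R : Set V)
    (ψ : Fin n → Fin n → V → V)
    (hR : ∀ i j : Fin n, i < j → (D i).verts ∩ (D j).verts = R)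
    (hbij : ∀ i j : Fin n, i < j → Set.BijOn (ψ i j) (D i).verts (D j).verts)
    (hid : ∀ i j : Fin n, i < j → ∀ x ∈ R, ψ i j x = x)
    (hiso : ∀ i j : Fin n, i < j → ∀ u v : V, u ∈ (D i).verts → v ∈ (D i).verts →
      ((D i).Arc u v ↔ (D j).Arc (ψ i j u) (ψ i j v)))
    (k : ℕ) (hk : 3 ≤ k) (hgirth : ∀ i : Fin n, (D i).DigirthGT k) :
    Digraph'.RelDigirthGT (fun u v => ∃ i : Fin n, (D i).Arc u v) k := by
  rcases n with _ | n
  · rintro m - c ⟨-, -, -, hc⟩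
    exact (hc 0).choose.elim0
  rcases isEmpty_or_nonempty V with _ | _
  · exact fun m _ c _ => isEmptyElim (c 0)
  let g : Fin (n + 1) → V → V := fun j =>
    if j = 0 then id else Function.invFunOn (ψ 0 j) (D 0).verts
  have hg0 : g 0 = id := if_pos rfl
  have hgs : ∀ j, 0 < j → g j = Function.invFunOn (ψ 0 j) (D 0).verts :=
    fun j hj => if_neg hj.ne'
  have hgR : ∀ j, ∀ x ∈ R, g j x = x := fun j x hx => by
    rcases (Fin.zero_le j).eq_or_lt with rfl | hj
    · rw [hg0, id]
    · have hx0 : x ∈ (D 0).verts := (hR 0 j hj ▸ hx : x ∈ (D 0).verts ∩ (D j).verts).1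
      have h := (hbij 0 j hj).injOn.leftInvOn_invFunOn hx0
      rwa [hid 0 j hj x hx, ← hgs j hj] at h
  obtain ⟨f, hf⟩ := Digraph'.exists_hom_union (F := (D 0).Arc) D g
    (fun j u v h => by
      rcases (Fin.zero_le j).eq_or_lt with rfl | hj
      · simpa only [hg0, id] using h
      · have hsurj := (hbij 0 j hj).surjOn
        have hu := (D j).arc_left h
        have hv := (D j).arc_right h
        rw [hgs j hj]
        refine (hiso 0 j hj _ _ (hsurj.mapsTo_invFunOn hu) (hsurj.mapsTo_invFunOn hv)).2 ?_
        rwa [hsurj.rightInvOn_invFunOn hu, hsurj.rightInvOn_invFunOn hv])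
    (fun i j x hi hj => by
      rcases lt_trichotomy i j with h | rfl | h
      · have hx : x ∈ R := hR i j h ▸ ⟨hi, hj⟩
        rw [hgR i x hx, hgR j x hx]
      · rfl
      · have hx : x ∈ R := hR j i h ▸ ⟨hj, hi⟩
        rw [hgR i x hx, hgR j x hx])
  exact Digraph'.RelDigirthGT.of_hom (hgirth 0) f hf
end

section
/- Let n < ω and let D_i (i < n) be digraphs on vertex sets V_i such that there is a single set R with V_i ∩ V_j = R for all i < j < n, and for all i < j < n there is a digraph isomorphism ψ_{i,j} : D_i → D_j which is the identity on R. Fix an integer k ≥ 3 with n > k and suppose each D_i has digirth greater than k. Suppose α_i ∈ V_i \ R are vertices with ψ_{i,j}(α_i) = α_j for all i < j < n. Let D* be the digraph obtained from D = ⋃_{i<n} D_i by adding the arcs (α_i, α_{i+1}) for i < n−1 together with the arc (α_{n−1}, α_0). Then D* has digirth greater than k. -/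
namespace Digraph'

variable {V : Type*}

theorem RelDigirthGT.no_closed_walk {E : V → V → Prop} {k : ℕ} (h : RelDigirthGT E k)
    (l : ℕ) (hl : 1 ≤ l) (hlk : l ≤ k) (w : ℕ → V) (hw : ∀ i < l, E (w i) (w (i + 1))) :
    w l ≠ w 0 := by
  induction l using Nat.strong_induction_on generalizing w with
  | _ l ih =>
    intro hclosed
    by_cases hinj : ∀ i < l, ∀ j < l, w i = w j → i = j
    · have : NeZero l := ⟨by omega⟩
      refine h l hlk (fun i => w i.val) ⟨hl, fun i j hij => ?_, fun _ => Set.mem_univ _,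
        fun i => ?_⟩
      · exact ZMod.val_injective l (hinj _ (ZMod.val_lt i) _ (ZMod.val_lt j) hij)
      · have hstep := hw _ (ZMod.val_lt i)
        have hval : (i + 1).val = (i.val + 1) % l := by
          conv_lhs => rw [← ZMod.natCast_zmod_val i]
          rw [← Nat.cast_succ, ZMod.val_natCast]
        have hlt := ZMod.val_lt i
        show E (w i.val) (w (i + 1).val)
        rw [hval]
        rcases Nat.lt_or_ge (i.val + 1) l with hi | hi
        · rwa [Nat.mod_eq_of_lt hi]
        · have heq : i.val + 1 = l := by omega
          rw [heq, hclosed] at hstep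
          rwa [heq, Nat.mod_self]
    · have key : ∀ i j, i < j → j < l → w i ≠ w j := by
        intro i j hij hj hwij
        refine ih (j - i) (by omega) (by omega) (by omega) (fun t => w (i + t))
          (fun t ht => hw (i + t) (by omega)) ?_
        simp only [Nat.add_sub_cancel' hij.le, add_zero, hwij]
      refine hinj fun i hi j hj hij => ?_
      rcases lt_trichotomy i j with hlt | heq | hlt
      · exact absurd hij (key i j hlt hj)
      · exact heq
      · exact absurd hij.symm (key j i hlt hi)

theorem exists_walk_of_lazy_walk {E : V → V → Prop} (m : ℕ) (w : ℕ → V)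
    (hw : ∀ i < m, E (w i) (w (i + 1)) ∨ w i = w (i + 1)) :
    ∃ l ≤ m, ∃ v : ℕ → V, v 0 = w 0 ∧ v l = w m ∧ (∀ i < l, E (v i) (v (i + 1))) ∧
      (l = 0 → ∀ i < m, w i = w (i + 1)) := by
  induction m with
  | zero => exact ⟨0, le_rfl, w, rfl, rfl, by simp, by simp⟩
  | succ m ih =>
    obtain ⟨l, hl, v, hv0, hvl, hv, hvz⟩ := ih fun i hi => hw i (by omega)
    rcases hw m (by omega) with hE | heq
    · refine ⟨l + 1, by omega, fun i => if i ≤ l then v i else w (m + 1), by simpa using hv0,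
        by simp, fun i hi => ?_, by omega⟩
      rcases Nat.lt_or_ge i l with hil | hil
      · simpa [hil.le, Nat.succ_le_of_lt hil] using hv i hil
      · obtain rfl : i = l := by omega
        simpa [hvl] using hE
    · refine ⟨l, by omega, v, hv0, hvl.trans heq, hv, fun hz i hi => ?_⟩
      rcases Nat.lt_or_ge i m with him | him
      · exact hvz hz i him
      · obtain rfl : i = m := by omega
        exact heq

/-- The union of the digraphs `D i`, amalgamated over `R`, folds onto any `D z` to which
each of the other `D i` is isomorphic over `R`. -/
theorem exists_fold {ι : Type*} (D : ι → Digraph' V) (R : Set V) (z : ι) (φ : ι → V → V)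
    (hR : ∀ i j, i ≠ j → (D i).verts ∩ (D j).verts = R) (hRz : R ⊆ (D z).verts)
    (hbij : ∀ i, Set.BijOn (φ i) (D z).verts (D i).verts)
    (hid : ∀ i, ∀ x ∈ R, φ i x = x)
    (hiso : ∀ i, ∀ u v : V, u ∈ (D z).verts → v ∈ (D z).verts →
      ((D z).Arc u v ↔ (D i).Arc (φ i u) (φ i v))) :
    ∃ π : V → V, (∀ i u v, (D i).Arc u v → (D z).Arc (π u) (π v)) ∧
      ∀ i, ∀ x ∈ (D z).verts, π (φ i x) = x := by
  classical
  have hφ : ∀ i j, ∀ x ∈ (D z).verts, ∀ y ∈ (D z).verts, φ i x = φ j y → x = y := by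
    intro i j x hx y hy hxy
    by_cases hij : i = j
    · subst hij
      exact (hbij i).injOn hx hy hxy
    · have hmem : φ i x ∈ R := by
        rw [← hR i j hij]
        exact ⟨(hbij i).mapsTo hx, hxy ▸ (hbij j).mapsTo hy⟩
      have hx' := (hbij i).injOn hx (hRz hmem) (hid i _ hmem).symm
      have hy' := (hbij j).injOn hy (hRz hmem) (hxy.symm.trans (hid j _ hmem).symm)
      exact hx'.trans hy'.symm
  have hex : ∀ y, ∃ x, ∀ i, ∀ x' ∈ (D z).verts, φ i x' = y → x = x' := by
    intro y
    by_cases h : ∃ i, ∃ x ∈ (D z).verts, φ i x = y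
    · obtain ⟨i, x, hx, rfl⟩ := h
      exact ⟨x, fun j x' hx' he => hφ i j x hx x' hx' he.symm⟩
    · exact ⟨y, fun i x' hx' he => absurd ⟨i, x', hx', he⟩ h⟩
  choose π hπ using hex
  refine ⟨π, fun i u v huv => ?_, fun i x hx => hπ _ i x hx rfl⟩
  obtain ⟨x, hx, rfl⟩ := (hbij i).surjOn ((D i).arc_left huv)
  obtain ⟨y, hy, rfl⟩ := (hbij i).surjOn ((D i).arc_right huv)
  rw [hπ _ i x hx rfl, hπ _ i y hy rfl]
  exact (hiso i x y hx hy).2 huv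

end Digraph'

/-- Amalgamation lemma, part (3): if moreover `n > k`, `aᵢ ∈ Vᵢ \ R` with `ψ i j aᵢ = aⱼ`,
then adding the arcs `(aᵢ, a_{i+1})` for `i < n - 1` together with `(a_{n-1}, a₀)` to the
union digraph still yields a digraph of digirth `> k`. -/
theorem statement_2 {V : Type*} (n : ℕ) (D : Fin n → Digraph' V) (R : Set V)
    (ψ : Fin n → Fin n → V → V)
    (hR : ∀ i j : Fin n, i < j → (D i).verts ∩ (D j).verts = R)
    (hbij : ∀ i j : Fin n, i < j → Set.BijOn (ψ i j) (D i).verts (D j).verts)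
    (hid : ∀ i j : Fin n, i < j → ∀ x ∈ R, ψ i j x = x)
    (hiso : ∀ i j : Fin n, i < j → ∀ u v : V, u ∈ (D i).verts → v ∈ (D i).verts →
      ((D i).Arc u v ↔ (D j).Arc (ψ i j u) (ψ i j v)))
    (k : ℕ) (hk : 3 ≤ k) (hn : k < n) (hgirth : ∀ i : Fin n, (D i).DigirthGT k)
    (a : Fin n → V) (ha : ∀ i : Fin n, a i ∈ (D i).verts \ R)
    (hψa : ∀ i j : Fin n, i < j → ψ i j (a i) = a j) :
    Digraph'.RelDigirthGT (fun u v =>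
      (∃ i : Fin n, (D i).Arc u v) ∨
      (∃ (m : ℕ) (h : m + 1 < n), u = a ⟨m, by omega⟩ ∧ v = a ⟨m + 1, h⟩) ∨
      (u = a ⟨n - 1, by omega⟩ ∧ v = a ⟨0, by omega⟩)) k := by
  have hne : ∀ i j, i ≠ j → (D i).verts ∩ (D j).verts = R := by
    intro i j hij
    rcases lt_or_gt_of_ne hij with h | h
    · exact hR i j h
    · rw [Set.inter_comm]
      exact hR j i h
  have ha_inj : ∀ i j, a i = a j → i = j := by
    intro i j hij
    by_contra h
    exact (ha i).2 (hne i j h ▸ ⟨(ha i).1, hij ▸ (ha j).1⟩)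
  let z : Fin n := ⟨0, by omega⟩
  have hz : ∀ i, i ≠ z → z < i := by
    intro i hi
    rw [Fin.lt_def]
    exact Nat.pos_of_ne_zero fun h => hi (Fin.ext h)
  have hRz : R ⊆ (D z).verts := by
    rw [← hR z ⟨1, by omega⟩ (by simp [z, Fin.lt_def])]
    exact Set.inter_subset_left
  obtain ⟨π, hπ, hπφ⟩ := Digraph'.exists_fold D R z (fun i => if i = z then id else ψ z i)
    hne hRz
    (fun i => by
      by_cases h : i = z
      · simpa [h] using Set.bijOn_id _
      · simpa [h] using hbij z i (hz i h))
    (fun i x hx => by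
      by_cases h : i = z
      · simp [h]
      · simpa [h] using hid z i (hz i h) x hx)
    (fun i u v hu hv => by
      by_cases h : i = z
      · simp [h]
      · simpa [h] using hiso z i (hz i h) u v hu hv)
  have hπa : ∀ i, π (a i) = a z := by
    intro i
    have := hπφ i (a z) (ha z).1
    by_cases h : i = z
    · simpa [h] using this
    · simpa [h, hψa z i (hz i h)] using this
  rintro m hmk c ⟨hm, -, -, hc⟩
  have hstep : ∀ i : ℕ, (∃ j, (D j).Arc (c i) (c (i + 1 : ℕ))) ∨
      ∃ p q : Fin n, q.val = (p.val + 1) % n ∧ c i = a p ∧ c (i + 1 : ℕ) = a q := by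
    intro i
    rw [Nat.cast_succ]
    rcases hc i with h | ⟨p, hp, h₁, h₂⟩ | ⟨h₁, h₂⟩
    · exact Or.inl h
    · exact Or.inr ⟨_, _, (Nat.mod_eq_of_lt hp).symm, h₁, h₂⟩
    · refine Or.inr ⟨_, _, ?_, h₁, h₂⟩
      simp [Nat.sub_add_cancel (show 1 ≤ n by omega)]
  have hclosed : c (m : ℕ) = c (0 : ℕ) := by simp
  obtain ⟨l, hlm, v, hv0, hvl, hv, hvz⟩ := Digraph'.exists_walk_of_lazy_walk
    (E := (D z).Arc) m (fun i => π (c i)) fun i _ => by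
      rcases hstep i with ⟨j, hj⟩ | ⟨p, q, -, hp, hq⟩
      · exact Or.inl (hπ j _ _ hj)
      · exact Or.inr (by rw [hp, hq, hπa, hπa])
  have hl : l = 0 := by
    by_contra hl
    refine (hgirth z).no_closed_walk l (by omega) (by omega) v hv ?_
    rw [hv0, hvl, hclosed]
  have hnew : ∀ i < m, ∃ p q : Fin n, q.val = (p.val + 1) % n ∧ c i = a p ∧
      c (i + 1 : ℕ) = a q := by
    intro i hi
    refine (hstep i).resolve_left ?_
    rintro ⟨j, hj⟩
    have harc := hπ j _ _ hj
    rw [← hvz hl i hi] at harc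
    exact (D z).irrefl' _ harc
  obtain ⟨p₀, -, -, hp₀, -⟩ := hnew 0 (by omega)
  have hrot : ∀ i ≤ m, c i = a ⟨(p₀.val + i) % n, Nat.mod_lt _ (by omega)⟩ := by
    intro i
    induction i with
    | zero =>
      intro _
      rw [hp₀]
      congr 1
      exact Fin.ext (Nat.mod_eq_of_lt p₀.isLt).symm
    | succ i ih =>
      intro hi
      obtain ⟨p, q, hpq, hp, hq⟩ := hnew i (by omega)
      have hpi := ha_inj _ _ (hp.symm.trans (ih (by omega)))
      rw [hq]
      congr 1
      refine Fin.ext ?_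
      rw [hpq, hpi]
      simp [Nat.add_assoc]
  have hwrap : (p₀.val + m) % n = p₀.val := congrArg Fin.val
    (ha_inj _ _ ((hrot m le_rfl).symm.trans (hclosed.trans hp₀)))
  have hp₀n := p₀.isLt
  rcases Nat.lt_or_ge (p₀.val + m) n with h | h
  · rw [Nat.mod_eq_of_lt h] at hwrap
    omega
  · rw [Nat.mod_eq_sub_mod h, Nat.mod_eq_of_lt (by omega)] at hwrap
    omega
end

section
/- Suppose a digraph D has uncountable dichromatic number. Then there is a subset W of V(D) such that the induced subdigraph D₀ = D[W] has uncountable dichromatic number and every vertex of D₀ has infinite in-degree and infinite out-degree in D₀. -/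
/-- Greedy colouring along a well-founded relation: if every vertex has only finitely many
smaller neighbours, then there is a colouring by natural numbers in which no vertex shares
its colour with a smaller neighbour. -/
theorem exists_nat_coloring_of_finite_smaller {V : Type*} {r : V → V → Prop}
    (hr : WellFounded r) (adj : V → V → Prop)
    (hfin : ∀ x, {y | r y x ∧ adj y x}.Finite) :
    ∃ c : V → ℕ, ∀ x y, r y x → adj y x → c y ≠ c x := by
  classical
  have key : ∀ x (c : ∀ y, r y x → ℕ), ∃ n : ℕ, ∀ y (h : r y x), adj y x → c y h ≠ n := by
    intro x c
    obtain ⟨n, hn⟩ := ((hfin x).image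
      (fun y => if h : r y x then c y h else 0)).exists_notMem
    refine ⟨n, fun y h ha hc => hn ⟨y, ⟨h, ha⟩, ?_⟩⟩
    simp [h, hc]
  choose g hg using key
  refine ⟨hr.fix g, fun x y hyx ha => ?_⟩
  rw [hr.fix_eq g x]
  exact hg x (fun y _ => hr.fix g y) y hyx ha

/-- The set of vertices reachable along a relation with finite out-degrees is countable. -/
theorem countable_setOf_reflTransGen {V : Type*} {E : V → V → Prop}
    (hfin : ∀ x, {y | E x y}.Finite) (x : V) :
    {y | Relation.ReflTransGen E x y}.Countable := by
  have hC : ∀ n : ℕ, ((fun S : Set V => ⋃ z ∈ S, {y | E z y})^[n] {x}).Countable := by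
    intro n
    induction n with
    | zero => simp
    | succ n ih =>
      rw [Function.iterate_succ_apply']
      exact ih.biUnion fun z _ => (hfin z).countable
  refine (Set.countable_iUnion hC).mono fun y hy => ?_
  induction hy with
  | refl => exact Set.mem_iUnion.2 ⟨0, rfl⟩
  | @tail b d _ hbd ih =>
    obtain ⟨n, hn⟩ := Set.mem_iUnion.1 ih
    refine Set.mem_iUnion.2 ⟨n + 1, ?_⟩
    rw [Function.iterate_succ_apply']
    exact Set.mem_biUnion hn hbd

/-- An irreflexive relation with finite out-degrees has countable chromatic number. -/
theorem exists_nat_coloring_of_finite_out {V : Type*} {E : V → V → Prop}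
    (hirr : ∀ x, ¬ E x x) (hfin : ∀ x, {y | E x y}.Finite) :
    ∃ c : V → ℕ, ∀ x y, E x y → c x ≠ c y := by
  classical
  let s : V → V → Prop := WellOrderingRel
  have hs : WellFounded s := IsWellFounded.wf
  have hne : ∀ x, {a | Relation.ReflTransGen E a x}.Nonempty := fun x => ⟨x, .refl⟩
  let ι : V → V := fun x => hs.min _ (hne x)
  have hι : ∀ x, Relation.ReflTransGen E (ι x) x := fun x => hs.min_mem _ (hne x)
  have hmono : ∀ x y, E x y → ¬ s (ι x) (ι y) := fun x y h =>
    hs.not_lt_min {a | Relation.ReflTransGen E a y} ((hι x).tail h)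
  have henum : ∀ a : V, ∃ n : V → ℕ, Set.InjOn n {y | Relation.ReflTransGen E a y} :=
    fun a => (Set.countable_iff_exists_injOn).1 (countable_setOf_reflTransGen hfin a)
  choose n hn using henum
  let p : V → V × ℕ := fun x => (ι x, n (ι x) x)
  let r : V → V → Prop := InvImage (Prod.Lex s (· < ·)) p
  have hr : WellFounded r := InvImage.wf p (hs.prod_lex wellFounded_lt)
  have htri : ∀ x y, x ≠ y → r x y ∨ r y x := by
    intro x y hxy
    simp only [r, InvImage, Prod.lex_def, p]
    rcases trichotomous_of s (ι x) (ι y) with h | h | h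
    · exact .inl (.inl h)
    · have : n (ι x) x ≠ n (ι y) y := by
        intro he
        rw [← h] at he
        exact hxy (hn (ι x) (hι x) (by rw [h]; exact hι y) he)
      rcases lt_or_gt_of_ne this with h' | h'
      · exact .inl (.inr ⟨h, h'⟩)
      · exact .inr (.inr ⟨h.symm, h'⟩)
    · exact .inr (.inl h)
  obtain ⟨c, hc⟩ := exists_nat_coloring_of_finite_smaller hr (fun y x => E x y ∨ E y x) (by
    intro x
    have hlow : {y | ι y = ι x ∧ n (ι x) y < n (ι x) x}.Finite := by
      refine Set.Finite.of_finite_image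
        ((Set.finite_lt_nat (n (ι x) x)).subset (t := n (ι x) '' _) ?_)
        ((hn (ι x)).mono ?_)
      · rintro _ ⟨y, hy, rfl⟩
        exact hy.2
      · rintro y ⟨hy, -⟩
        rw [← hy]
        exact hι y
    refine ((hfin x).union hlow).subset ?_
    rintro y ⟨hyx, hE | hE⟩
    · exact .inl hE
    · rcases (Prod.lex_def.1 hyx) with h | ⟨h, h'⟩
      · exact (hmono y x hE h).elim
      · refine .inr ⟨h, ?_⟩
        simp only [p] at h h'
        rwa [h] at h')
  refine ⟨c, fun x y hxy => ?_⟩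
  rcases htri x y (fun h => hirr x (by rw [← h] at hxy; exact hxy)) with h | h
  · exact hc y x h (.inr hxy)
  · exact (hc x y h (.inl hxy)).symm

/-- If every vertex of `A` has finitely many out-neighbours in `A` of at least its own rank, then
`A` can be coloured by natural numbers so that the rank drops along each monochromatic arc. -/
theorem exists_nat_coloring_rank_lt {V : Type*} {α : Type*} [LinearOrder α] {E : V → V → Prop}
    (hirr : ∀ x, ¬ E x x) (rank : V → α) (A : Set V)
    (hfin : ∀ x ∈ A, {y | y ∈ A ∧ E x y ∧ rank x ≤ rank y}.Finite) :
    ∃ c : V → ℕ, ∀ x ∈ A, ∀ y ∈ A, E x y → c x = c y → rank y < rank x := by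
  obtain ⟨c, hc⟩ := exists_nat_coloring_of_finite_out
    (E := fun x y => x ∈ A ∧ y ∈ A ∧ E x y ∧ rank x ≤ rank y)
    (fun x h => hirr x h.2.2.1) (by
      intro x
      by_cases hx : x ∈ A
      · exact (hfin x hx).subset fun y hy => hy.2
      · simp [hx])
  refine ⟨c, fun x hx y hy hxy hcol => ?_⟩
  by_contra! hle
  exact hc x y ⟨hx, hy, hxy, hle⟩ hcol

namespace Digraph'

/-- A set on which some rank strictly decreases along arcs is acyclic. -/
theorem acyclicSet_of_rank {V : Type*} {α : Type*} [LinearOrder α] (D : Digraph' V) (B : Set V)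
    (rank : V → α) (h : ∀ x ∈ B, ∀ y ∈ B, D.Arc x y → rank y < rank x) : D.AcyclicSet B := by
  rintro m c ⟨hm, -, hB, hE⟩
  have : NeZero m := ⟨by omega⟩
  obtain ⟨i, hi⟩ := Finite.exists_min (fun i => rank (c i))
  exact (hi (i + 1)).not_gt (h _ (hB i) _ (hB _) (hE i))

/-- The operator sending `U` to the set of vertices with infinitely many in-neighbours and
infinitely many out-neighbours in `U`. -/
def infiniteDegreeOp {V : Type*} (D : Digraph' V) : Set V →o Set V where
  toFun U := {x | {u | u ∈ U ∧ D.Arc u x}.Infinite ∧ {u | u ∈ U ∧ D.Arc x u}.Infinite}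
  monotone' _ _ hUU' _ hx :=
    ⟨hx.1.mono fun _ hu => ⟨hUU' hu.1, hu.2⟩, hx.2.mono fun _ hu => ⟨hUU' hu.1, hu.2⟩⟩

open OrdinalApprox in
/-- Outside the greatest fixed point of `infiniteDegreeOp` the vertices can be ranked by ordinals
so that each has finite in-degree or finite out-degree among vertices of at least its rank. -/
theorem exists_rank_finite_degree.{u} {V : Type u} (D : Digraph' V) :
    ∃ rank : V → Ordinal.{u}, ∀ x ∉ D.infiniteDegreeOp.gfp,
      {y | y ∉ D.infiniteDegreeOp.gfp ∧ D.Arc y x ∧ rank x ≤ rank y}.Finite ∨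
      {y | y ∉ D.infiniteDegreeOp.gfp ∧ D.Arc x y ∧ rank x ≤ rank y}.Finite := by
  set f := D.infiniteDegreeOp
  refine ⟨fun x => sInf {a | x ∉ gfpApprox f ⊤ a}, fun x hx => ?_⟩
  have hne : ∀ y, y ∉ f.gfp → {a | y ∉ gfpApprox f ⊤ a}.Nonempty := fun y hy =>
    ⟨_, by rw [← gfpApprox_ord_eq_gfp] at hy; exact hy⟩
  have hmem := csInf_mem (hne x hx)
  have hlow : ∀ y, ∀ b < sInf {a | y ∉ gfpApprox f ⊤ a}, y ∈ gfpApprox f ⊤ b := by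
    intro y b hb
    by_contra h
    exact notMem_of_lt_csInf' hb h
  obtain ⟨b, hb, hxb⟩ : ∃ b < sInf {a | x ∉ gfpApprox f ⊤ a}, x ∉ f (gfpApprox f ⊤ b) := by
    by_contra! hcon
    apply hmem
    rw [gfpApprox]
    simpa using hcon
  have hxb' : ¬ ({u | u ∈ gfpApprox f ⊤ b ∧ D.Arc u x}.Infinite ∧
      {u | u ∈ gfpApprox f ⊤ b ∧ D.Arc x u}.Infinite) := hxb
  rw [not_and_or, Set.not_infinite, Set.not_infinite] at hxb'
  refine hxb'.imp (fun h => h.subset ?_) (fun h => h.subset ?_)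
  · exact fun y hy => ⟨hlow y b (hb.trans_le hy.2.2), hy.2.1⟩
  · exact fun y hy => ⟨hlow y b (hb.trans_le hy.2.2), hy.2.1⟩

/-- The complement of the greatest fixed point of `infiniteDegreeOp` is covered by countably many
acyclic sets. -/
theorem exists_acyclic_cover_compl_gfp {V : Type*} (D : Digraph' V) :
    ∃ F : ℕ ⊕ ℕ → Set V, (∀ n, D.AcyclicSet (F n)) ∧ D.infiniteDegreeOp.gfpᶜ ⊆ ⋃ n, F n := by
  obtain ⟨rank, hrank⟩ := D.exists_rank_finite_degree
  set W := D.infiniteDegreeOp.gfp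
  let A : Set V := {x | x ∉ W ∧ {y | y ∉ W ∧ D.Arc y x ∧ rank x ≤ rank y}.Finite}
  let B : Set V := {x | x ∉ W ∧ {y | y ∉ W ∧ D.Arc x y ∧ rank x ≤ rank y}.Finite}
  obtain ⟨a, ha⟩ := exists_nat_coloring_rank_lt (E := fun x y => D.Arc y x) D.irrefl' rank A
    fun x hx => hx.2.subset fun y hy => ⟨hy.1.1, hy.2⟩
  obtain ⟨b, hb⟩ := exists_nat_coloring_rank_lt D.irrefl' rank B
    fun x hx => hx.2.subset fun y hy => ⟨hy.1.1, hy.2⟩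
  refine ⟨Sum.elim (fun n => {x ∈ A | a x = n}) (fun n => {x ∈ B | b x = n}), ?_, ?_⟩
  · rintro (n | n)
    · exact D.acyclicSet_of_rank _ (fun x => OrderDual.toDual (rank x))
        fun x hx y hy hxy => ha y hy.1 x hx.1 hxy (hy.2.trans hx.2.symm)
    · exact D.acyclicSet_of_rank _ rank
        fun x hx y hy hxy => hb x hx.1 y hy.1 hxy (hx.2.trans hy.2.symm)
  · intro x hx
    rcases hrank x hx with h | h
    · exact Set.mem_iUnion.2 ⟨.inl (a x), ⟨hx, h⟩, rfl⟩
    · exact Set.mem_iUnion.2 ⟨.inr (b x), ⟨hx, h⟩, rfl⟩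

/-- To have countable dichromatic number it suffices to be covered by acyclic sets indexed by a
countable type. -/
theorem UncountableDichromatic.not_subset_iUnion {V : Type*} {D : Digraph' V}
    (h : D.UncountableDichromatic) {κ : Type*} [Countable κ] [Nonempty κ] {F : κ → Set V}
    (hF : ∀ k, D.AcyclicSet (F k)) : ¬ D.verts ⊆ ⋃ k, F k := by
  intro hcov
  obtain ⟨e, he⟩ := exists_surjective_nat κ
  exact h ⟨F ∘ e, fun n => hF _, hcov.trans (he.iUnion_comp F).ge⟩

/-- The part inside `A` of an acyclic set of `D.induce A` is acyclic in `D`. -/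
theorem AcyclicSet.inter_of_induce {V : Type*} {D : Digraph' V} {A B : Set V}
    (h : (D.induce A).AcyclicSet B) : D.AcyclicSet (B ∩ A) :=
  fun m c ⟨hm, hinj, hmem, hE⟩ =>
    h m c ⟨hm, hinj, fun i => (hmem i).1, fun i => ⟨hE i, (hmem i).2, (hmem _).2⟩⟩

end Digraph'

/-- Every digraph with uncountable dichromatic number has an induced subdigraph with
uncountable dichromatic number all of whose vertices have infinite in- and out-degree. -/
theorem statement_3 {V : Type*} (D : Digraph' V) (h : D.UncountableDichromatic) :
    ∃ W : Set V, (D.induce W).UncountableDichromatic ∧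
      ∀ v ∈ (D.induce W).verts,
        {u : V | (D.induce W).Arc u v}.Infinite ∧
        {u : V | (D.induce W).Arc v u}.Infinite := by
  refine ⟨D.infiniteDegreeOp.gfp, ?_, ?_⟩
  · rintro ⟨F, hF, hcov⟩
    obtain ⟨G, hG, hGcov⟩ := D.exists_acyclic_cover_compl_gfp
    refine h.not_subset_iUnion
      (F := Sum.elim (fun n => F n ∩ D.infiniteDegreeOp.gfp) G) ?_ ?_
    · rintro (n | n)
      · exact (hF n).inter_of_induce
      · exact hG n
    · intro x hx
      by_cases hxW : x ∈ D.infiniteDegreeOp.gfp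
      · obtain ⟨n, hn⟩ := Set.mem_iUnion.1 (hcov ⟨hx, hxW⟩)
        exact Set.mem_iUnion.2 ⟨.inl n, hn, hxW⟩
      · obtain ⟨n, hn⟩ := Set.mem_iUnion.1 (hGcov hxW)
        exact Set.mem_iUnion.2 ⟨.inr n, hn⟩
  · rintro v ⟨-, hv⟩
    have hv' : v ∈ D.infiniteDegreeOp D.infiniteDegreeOp.gfp := by
      rwa [D.infiniteDegreeOp.map_gfp]
    exact ⟨hv'.1.mono fun u hu => ⟨hu.2, hu.1, hv⟩, hv'.2.mono fun u hu => ⟨hu.2, hv, hu.1⟩⟩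
end

section
/- The one-way infinite directed path ⃗P_ω embeds into every digraph D with uncountable dichromatic number. -/
/-- The one-way infinite directed path: vertices `ℕ`, arcs `(n, n+1)`. -/
def dipathOmega : Digraph' ℕ where
  verts := Set.univ
  Arc m n := n = m + 1
  arc_left := fun _ _ _ => Set.mem_univ _
  arc_right := fun _ _ _ => Set.mem_univ _
  irrefl' := fun v h => by omega
  asymm' := fun u v h h' => by omega

namespace Digraph'

/-- The set `S` can be covered by countably many acyclic sets. -/
def CountablyDichromatic {V : Type*} (D : Digraph' V) (S : Set V) : Prop :=
  ∃ F : ℕ → Set V, (∀ n, D.AcyclicSet (F n)) ∧ S ⊆ ⋃ n, F n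

/-- The vertices reachable from `w` by a directed walk all of whose vertices,
except possibly `w`, lie in `A`. -/
def reach {V : Type*} (D : Digraph' V) (A : Set V) (w : V) : Set V :=
  {x | Relation.ReflTransGen (fun a b => D.Arc a b ∧ b ∈ A) w x}

theorem mem_reach_self {V : Type*} (D : Digraph' V) (A : Set V) (w : V) : w ∈ D.reach A w :=
  Relation.ReflTransGen.refl

theorem mem_reach_of_arc {V : Type*} {D : Digraph' V} {A : Set V} {w x y : V}
    (hx : x ∈ D.reach A w) (hxy : D.Arc x y) (hy : y ∈ A) : y ∈ D.reach A w :=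
  Relation.ReflTransGen.tail hx ⟨hxy, hy⟩

theorem reach_subset {V : Type*} {D : Digraph' V} {A : Set V} {w : V} (hw : w ∈ A) :
    D.reach A w ⊆ A := by
  intro x hx
  rcases Relation.ReflTransGen.cases_tail hx with h | ⟨_, _, h⟩
  · exact h ▸ hw
  · exact h.2

theorem acyclicSet_singleton {V : Type*} (D : Digraph' V) (v : V) : D.AcyclicSet {v} := by
  rintro m c ⟨-, -, hmem, harc⟩
  have h := harc 0
  rw [hmem 0, hmem (0 + 1)] at h
  exact D.irrefl' v h

theorem CountablyDichromatic.mono {V : Type*} {D : Digraph' V} {S T : Set V}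
    (hT : D.CountablyDichromatic T) (h : S ⊆ T) : D.CountablyDichromatic S :=
  let ⟨F, hF, hTF⟩ := hT
  ⟨F, hF, h.trans hTF⟩

theorem CountablyDichromatic.insert {V : Type*} {D : Digraph' V} {S : Set V}
    (hS : D.CountablyDichromatic S) (v : V) : D.CountablyDichromatic (insert v S) := by
  obtain ⟨F, hF, hSF⟩ := hS
  refine ⟨fun n => Nat.casesOn n {v} F, ?_, ?_⟩
  · rintro (_ | n)
    · exact D.acyclicSet_singleton v
    · exact hF n
  · rintro x (rfl | hx)
    · exact Set.mem_iUnion.2 ⟨0, rfl⟩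
    · obtain ⟨n, hn⟩ := Set.mem_iUnion.1 (hSF hx)
      exact Set.mem_iUnion.2 ⟨n + 1, hn⟩

/-- A function on a finite cyclic group that never increases along `i ↦ i + 1` is constant. -/
theorem eq_zero_of_succ_le {α : Type*} [PartialOrder α] {m : ℕ} (hm : 1 ≤ m) {f : ZMod m → α}
    (hf : ∀ i, f (i + 1) ≤ f i) (i : ZMod m) : f i = f 0 := by
  have : NeZero m := ⟨by omega⟩
  have hanti : Antitone fun n : ℕ => f n :=
    antitone_nat_of_succ_le fun n => by simpa using hf n
  have h₁ := hanti (Nat.zero_le i.val)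
  have h₂ := hanti i.val_lt.le
  simp only [ZMod.natCast_val, ZMod.cast_id', id, Nat.cast_zero, ZMod.natCast_self] at h₁ h₂
  exact le_antisymm h₁ h₂

/-- A union of sets of the form `D.reach A w` is countably dichromatic as soon as each of them
is: colour every vertex according to the first of these sets containing it. -/
theorem countablyDichromatic_biUnion_reach {V : Type*} {D : Digraph' V} {A N : Set V} (hN : N ⊆ A)
    (h : ∀ w ∈ N, D.CountablyDichromatic (D.reach A w)) :
    D.CountablyDichromatic (⋃ w ∈ N, D.reach A w) := by
  obtain ⟨_, _⟩ := exists_wellFoundedLT V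
  choose! F hF hcover using h
  refine ⟨fun n => {x | ∃ w, w ∈ N ∧ x ∈ D.reach A w ∧
    (∀ w' ∈ N, x ∈ D.reach A w' → w ≤ w') ∧ x ∈ F w n}, ?_, ?_⟩
  · rintro n m c ⟨hm, hinj, hmem, harc⟩
    choose f hfN hfr hfmin hfF using hmem
    have hconst := eq_zero_of_succ_le hm fun i =>
      hfmin (i + 1) (f i) (hfN i)
        (mem_reach_of_arc (hfr i) (harc i) (reach_subset (hN (hfN _)) (hfr (i + 1))))
    exact hF (f 0) (hfN 0) n m c ⟨hm, hinj, fun i => hconst i ▸ hfF i, harc⟩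
  · intro x hx
    simp only [Set.mem_iUnion, exists_prop] at hx
    obtain ⟨w, ⟨hwN, hwx⟩, hmin⟩ :=
      wellFounded_lt.has_min {w | w ∈ N ∧ x ∈ D.reach A w} hx
    obtain ⟨n, hn⟩ := Set.mem_iUnion.1 (hcover w hwN hwx)
    exact Set.mem_iUnion.2
      ⟨n, w, hwN, hwx, fun w' hw' hx' => not_lt.1 (hmin w' ⟨hw', hx'⟩), hn⟩

theorem reach_subset_insert {V : Type*} (D : Digraph' V) (A : Set V) (v : V) :
    D.reach A v ⊆ insert v (⋃ w ∈ {w | D.Arc v w ∧ w ∈ A \ {v}}, D.reach (A \ {v}) w) := by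
  intro x hx
  induction hx with
  | refl => exact Set.mem_insert _ _
  | @tail x y _ hxy ih =>
    by_cases hy : y = v
    · exact Or.inl hy
    refine Or.inr ?_
    have hyA : y ∈ A \ {v} := ⟨hxy.2, hy⟩
    simp only [Set.mem_iUnion, exists_prop, Set.mem_insert_iff] at ih ⊢
    rcases ih with rfl | ⟨w, hw, hwx⟩
    · exact ⟨y, ⟨hxy.1, hyA⟩, mem_reach_self ..⟩
    · exact ⟨w, hw, mem_reach_of_arc hwx hxy.1 hyA⟩

theorem exists_arc_not_countablyDichromatic_reach {V : Type*} {D : Digraph' V} {A : Set V} {v : V}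
    (h : ¬ D.CountablyDichromatic (D.reach A v)) :
    ∃ w, D.Arc v w ∧ w ∈ A \ {v} ∧ ¬ D.CountablyDichromatic (D.reach (A \ {v}) w) := by
  by_contra! hcon
  exact h (((countablyDichromatic_biUnion_reach (fun _ hw => hw.2)
    fun w hw => hcon w hw.1 hw.2).insert v).mono (D.reach_subset_insert A v))

theorem UncountableDichromatic.exists_not_countablyDichromatic_reach {V : Type*} {D : Digraph' V}
    (h : D.UncountableDichromatic) :
    ∃ v ∈ D.verts, ¬ D.CountablyDichromatic (D.reach D.verts v) := by
  by_contra! hcon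
  exact h ((countablyDichromatic_biUnion_reach subset_rfl hcon).mono
    fun v hv => Set.mem_biUnion hv (mem_reach_self ..))

end Digraph'

/-- `⃗P_ω` embeds into every digraph with uncountable dichromatic number. -/
theorem statement_4 {V : Type*} (D : Digraph' V) (h : D.UncountableDichromatic) :
    dipathOmega.Embeds D := by
  obtain ⟨v₀, hv₀, hbig⟩ := h.exists_not_countablyDichromatic_reach
  let State := {p : Set V × V // p.2 ∈ p.1 ∧ ¬ D.CountablyDichromatic (D.reach p.1 p.2)}
  have hstep (p : State) : ∃ q : State, D.Arc p.1.2 q.1.2 ∧ q.1.1 = p.1.1 \ {p.1.2} := by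
    obtain ⟨w, hw, hwA, hwbig⟩ := Digraph'.exists_arc_not_countablyDichromatic_reach p.2.2
    exact ⟨⟨(_, w), hwA, hwbig⟩, hw, rfl⟩
  choose next harc hset using hstep
  let s : ℕ → State := fun n => next^[n] ⟨(D.verts, v₀), hv₀, hbig⟩
  have hs (n : ℕ) : s (n + 1) = next (s n) := Function.iterate_succ_apply' ..
  have hsarc (n : ℕ) : D.Arc (s n).1.2 (s (n + 1)).1.2 := hs n ▸ harc (s n)
  have hsset (n : ℕ) : (s (n + 1)).1.1 = (s n).1.1 \ {(s n).1.2} := hs n ▸ hset (s n)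
  have hanti : Antitone fun n => (s n).1.1 :=
    antitone_nat_of_succ_le fun n => (hsset n).trans_subset Set.sdiff_subset
  have hne {m n : ℕ} (hmn : m < n) : (s m).1.2 ≠ (s n).1.2 := by
    intro heq
    have hmem : (s n).1.2 ∈ (s (m + 1)).1.1 := hanti hmn (s n).2.1
    rw [hsset m] at hmem
    exact hmem.2 heq.symm
  refine ⟨fun n => (s n).1.2, fun m _ n _ heq => ?_, fun n _ => D.arc_left (hsarc n), ?_⟩
  · by_contra hmn
    rcases Nat.lt_or_gt_of_ne hmn with hlt | hlt
    · exact hne hlt heq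
    · exact hne hlt heq.symm
  · rintro m n rfl
    exact hsarc m
end

section
/- Let T be any orientation of the everywhere ω-branching rooted tree, i.e., of the undirected graph on vertex set ω^{<ω} (finite sequences of natural numbers) whose edges are the pairs {t, t⌢⟨n⟩} for t ∈ ω^{<ω} and n < ω. Then T embeds into every digraph D with uncountable dichromatic number. -/
namespace WellFounded

/-- Choosing values one after the other along a well-founded relation, each value subject to
a satisfiable constraint on the values chosen before. -/
theorem exists_fun_of_forall_exists {α β : Type*} {r : α → α → Prop} (hr : WellFounded r)
    (Q : ∀ a : α, (∀ b, r b a → β) → β → Prop) (hQ : ∀ a g, ∃ y, Q a g y) :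
    ∃ F : α → β, ∀ a, Q a (fun b _ => F b) (F a) := by
  choose step hstep using hQ
  refine ⟨hr.fix step, fun a => ?_⟩
  conv => arg 3; rw [hr.fix_eq]
  exact hstep _ _

/-- Greedy colouring: if every vertex has only finitely many earlier neighbours, there is
a proper colouring with colours in `ℕ`. -/
theorem exists_nat_coloring {α : Type*} {r : α → α → Prop} (hr : WellFounded r)
    (N : α → Set α) (hN : ∀ a, {b | b ∈ N a ∧ r b a}.Finite) :
    ∃ c : α → ℕ, ∀ a, ∀ b ∈ N a, r b a → c b ≠ c a := by
  refine hr.exists_fun_of_forall_exists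
    (fun a g n => ∀ b ∈ N a, ∀ h : r b a, g b h ≠ n) fun a g => ?_
  have : Finite {b | b ∈ N a ∧ r b a} := hN a
  obtain ⟨n, hn⟩ := (Set.finite_range fun b : {b | b ∈ N a ∧ r b a} => g b b.2.2).exists_notMem
  exact ⟨n, fun b hb h e => hn ⟨⟨b, hb, h⟩, e⟩⟩

end WellFounded

theorem Set.countable_setOf_reflTransGen {α : Type*} {f : α → Set α}
    (hf : ∀ a, (f a).Countable) (a : α) :
    {b | Relation.ReflTransGen (fun x y => y ∈ f x) a b}.Countable := by
  let L : ℕ → Set α := fun n => Nat.rec {a} (fun _ s => ⋃ x ∈ s, f x) n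
  have hL : ∀ n, (L n).Countable := fun n => by
    induction n with
    | zero => exact Set.countable_singleton a
    | succ n ih => exact ih.biUnion fun x _ => hf x
  refine (Set.countable_iUnion hL).mono fun b hb => ?_
  induction hb with
  | refl => exact Set.mem_iUnion.2 ⟨0, rfl⟩
  | tail _ hc ih =>
    obtain ⟨n, hn⟩ := Set.mem_iUnion.1 ih
    exact Set.mem_iUnion.2 ⟨n + 1, Set.mem_biUnion hn hc⟩

/-- A set mapping with finite values decomposes its domain into countably many free sets. -/
theorem exists_nat_coloring_of_finite_setMapping {α : Type*} (f : α → Set α)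
    (hf : ∀ a, (f a).Finite) : ∃ c : α → ℕ, ∀ a, ∀ b ∈ f a, b ≠ a → c b ≠ c a := by
  obtain ⟨_, _⟩ := exists_wellFoundedLT α
  let C : α → Set α := fun a => {b | Relation.ReflTransGen (fun x y => y ∈ f x) a b}
  have hC : ∀ a, (C a).Countable := Set.countable_setOf_reflTransGen fun a => (hf a).countable
  have hlt : WellFounded ((· < ·) : α → α → Prop) := wellFounded_lt
  have hne : ∀ a, {b | a ∈ C b}.Nonempty := fun a => ⟨a, Relation.ReflTransGen.refl⟩
  let p : α → α := fun a => hlt.min _ (hne a)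
  have hp : ∀ a, a ∈ C (p a) := fun a => hlt.min_mem _ (hne a)
  have hpf : ∀ a, ∀ b ∈ f a, p b ≤ p a := fun a b hb =>
    not_lt.1 (hlt.not_lt_min _ (show p a ∈ {x | b ∈ C x} from (hp a).tail hb))
  choose e he using fun a => Set.countable_iff_exists_injOn.1 (hC a)
  let key : α → α ×ₗ ℕ := fun a => toLex (p a, e (p a) a)
  have hkey : Function.Injective key := fun a b hab => by
    have h1 : p a = p b := congrArg (fun x => (ofLex x).1) hab
    have h2 : e (p a) a = e (p b) b := congrArg (fun x => (ofLex x).2) hab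
    exact he (p a) (hp a) (h1 ▸ hp b) (h2.trans (by rw [h1]))
  obtain ⟨c, hc⟩ := (InvImage.wf key (wellFounded_lt (α := α ×ₗ ℕ))).exists_nat_coloring
    (fun a => {b | b ∈ f a ∨ a ∈ f b}) fun a => by
      have hfin : (C (p a) ∩ e (p a) ⁻¹' Set.Iio (e (p a) a)).Finite :=
        Set.Finite.of_finite_image ((Set.finite_Iio (e (p a) a)).subset
          (Set.image_subset_iff.2 Set.inter_subset_right)) ((he (p a)).mono Set.inter_subset_left)
      refine ((hf a).union hfin).subset ?_
      rintro b ⟨hb | hb, hlt' : key b < key a⟩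
      · exact Or.inl hb
      · rcases (Prod.Lex.toLex_lt_toLex).1 hlt' with h | ⟨h, h'⟩
        · exact absurd h (not_lt.2 (hpf b a hb))
        · have h : p b = p a := h
          have h' : e (p b) b < e (p a) a := h'
          exact Or.inr ⟨h ▸ hp b, by rw [h] at h'; exact h'⟩
  refine ⟨c, fun a b hb hne => ?_⟩
  rcases lt_or_gt_of_ne (hkey.ne hne) with h | h
  · exact hc a b (Or.inl hb) h
  · exact (hc b a (Or.inr hb) h).symm

namespace Digraph'

universe u

theorem acyclicSet_of_forall_lt {V β : Type*} [LinearOrder β] {D : Digraph' V} {A : Set V}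
    (φ : V → β) (h : ∀ u ∈ A, ∀ v ∈ A, D.Arc u v → φ u < φ v) : D.AcyclicSet A := by
  rintro m c ⟨hm, -, hA, hc⟩
  have : NeZero m := ⟨by omega⟩
  obtain ⟨i, hi⟩ := Finite.exists_max (φ ∘ c)
  exact absurd (h _ (hA i) _ (hA (i + 1)) (hc i)) (not_lt.2 (hi (i + 1)))

/-- `D.RemovedAt o v`: the vertex `v` can be removed at stage `o` of the elimination procedure
that removes vertices with finitely many remaining out-neighbours or finitely many remaining
in-neighbours. -/
inductive RemovedAt {V : Type u} (D : Digraph' V) : Ordinal.{u} → V → Prop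
  | out (o : Ordinal.{u}) (v : V) (S : Set V) (hS : S.Finite) (f : V → Ordinal.{u})
      (hlt : ∀ w, D.Arc v w → w ∉ S → f w < o)
      (hf : ∀ w, D.Arc v w → w ∉ S → D.RemovedAt (f w) w) : D.RemovedAt o v
  | inn (o : Ordinal.{u}) (v : V) (S : Set V) (hS : S.Finite) (f : V → Ordinal.{u})
      (hlt : ∀ w, D.Arc w v → w ∉ S → f w < o)
      (hf : ∀ w, D.Arc w v → w ∉ S → D.RemovedAt (f w) w) : D.RemovedAt o v

/-- If every vertex is eventually removed, countably many acyclic sets suffice. -/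
theorem not_uncountableDichromatic_of_forall_removedAt {V : Type u} {D : Digraph' V}
    (h : ∀ v, ∃ o, D.RemovedAt o v) : ¬ D.UncountableDichromatic := by
  refine not_not_intro ?_
  let r : V → Ordinal.{u} := fun v => sInf {o | D.RemovedAt o v}
  have hr : ∀ v, D.RemovedAt (r v) v := fun v => csInf_mem (h v)
  have hle : ∀ {v o}, D.RemovedAt o v → r v ≤ o := fun ho => csInf_le' ho
  have key : ∀ v, ∃ S : Set V, S.Finite ∧ ((∀ w, D.Arc v w → w ∉ S → r w < r v) ∨
      ∀ w, D.Arc w v → w ∉ S → r w < r v) := fun v => by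
    cases hr v with
    | out _ _ S hS f hlt hf =>
      exact ⟨S, hS, Or.inl fun w hw hwS => (hle (hf w hw hwS)).trans_lt (hlt w hw hwS)⟩
    | inn _ _ S hS f hlt hf =>
      exact ⟨S, hS, Or.inr fun w hw hwS => (hle (hf w hw hwS)).trans_lt (hlt w hw hwS)⟩
  choose S hS hSr using key
  obtain ⟨c, hc⟩ := exists_nat_coloring_of_finite_setMapping S hS
  have hfree : ∀ {v w n}, c v = n → c w = n → w ≠ v → w ∉ S v := fun hv hw hne hm =>
    hc _ _ hm hne (hw.trans hv.symm)
  let O : Set V := {v | ∀ w, D.Arc v w → w ∉ S v → r w < r v}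
  let F : ℕ ⊕ ℕ → Set V := Sum.elim (fun n => {v | c v = n} ∩ O) (fun n => {v | c v = n} \ O)
  have hF : ∀ i, D.AcyclicSet (F i) := by
    rintro (n | n)
    · refine acyclicSet_of_forall_lt (fun v => OrderDual.toDual (r v)) fun u hu v hv huv => ?_
      exact OrderDual.toDual_lt_toDual.2 (hu.2 v huv (hfree hu.1 hv.1
        fun e => D.irrefl' u (e ▸ huv)))
    · refine acyclicSet_of_forall_lt r fun u hu v hv huv => ?_
      exact (hSr v).resolve_left hv.2 u huv (hfree hv.1 hu.1 fun e => D.irrefl' u (e ▸ huv))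
  refine ⟨fun n => F (Denumerable.ofNat (ℕ ⊕ ℕ) n), fun n => hF _, fun v _ => ?_⟩
  by_cases hv : v ∈ O
  · exact Set.mem_iUnion.2 ⟨Encodable.encode (Sum.inl (c v) : ℕ ⊕ ℕ), by
      simp only [Denumerable.ofNat_encode]; exact ⟨rfl, hv⟩⟩
  · exact Set.mem_iUnion.2 ⟨Encodable.encode (Sum.inr (c v) : ℕ ⊕ ℕ), by
      simp only [Denumerable.ofNat_encode]; exact ⟨rfl, hv⟩⟩

/-- A digraph of uncountable dichromatic number contains a nonempty subdigraph all of whose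
vertices have infinite out-degree and infinite in-degree. -/
theorem UncountableDichromatic.exists_infinite_degrees {V : Type u} {D : Digraph' V}
    (h : D.UncountableDichromatic) : ∃ W : Set V, W.Nonempty ∧ ∀ v ∈ W,
      {w | w ∈ W ∧ D.Arc v w}.Infinite ∧ {w | w ∈ W ∧ D.Arc w v}.Infinite := by
  classical
  refine ⟨{v | ¬ ∃ o, D.RemovedAt o v}, ?_, fun v hv => ?_⟩
  · by_contra hempty
    refine not_uncountableDichromatic_of_forall_removedAt (fun v => ?_) h
    by_contra hv
    exact hempty ⟨v, hv⟩
  · let f : V → Ordinal.{u} := fun w => if hw : ∃ o, D.RemovedAt o w then hw.choose else 0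
    have hf : ∀ w, (∃ o, D.RemovedAt o w) → D.RemovedAt (f w) w := fun w hw => by
      simp only [f, dif_pos hw]
      exact hw.choose_spec
    have hlt : ∀ w, f w < Order.succ (⨆ w, f w) := fun w =>
      Order.lt_succ_of_le (Ordinal.le_iSup f w)
    constructor <;> intro hfin
    · exact hv ⟨_, .out _ v _ hfin f (fun w _ _ => hlt w) fun w hw hwS =>
        hf w (by_contra fun hn => hwS ⟨hn, hw⟩)⟩
    · exact hv ⟨_, .inn _ v _ hfin f (fun w _ _ => hlt w) fun w hw hwS =>
        hf w (by_contra fun hn => hwS ⟨hn, hw⟩)⟩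

end Digraph'

theorem List.encode_reverse_lt_encode_reverse_append_singleton (t : List ℕ) (m : ℕ) :
    Encodable.encode t.reverse < Encodable.encode (t ++ [m]).reverse := by
  rw [List.reverse_append, List.reverse_singleton, List.singleton_append,
    Encodable.encode_list_cons]
  exact Nat.lt_succ_of_le (Nat.right_le_pair _ _)

/-- Building an injective map on the tree `ω^{<ω}` node by node: if every possible image of
a parent leaves infinitely many choices for each child, all choices can be made injectively. -/
theorem exists_injective_of_infinite_children {α : Type*} [Nonempty α]
    (R : List ℕ → ℕ → α → α → Prop) (hR : ∀ t m x, {y | R t m x y}.Infinite) :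
    ∃ f : List ℕ → α, Function.Injective f ∧ ∀ t m, R t m (f t) (f (t ++ [m])) := by
  have hwf : WellFounded fun s t : List ℕ =>
      Encodable.encode s.reverse < Encodable.encode t.reverse :=
    InvImage.wf (fun t : List ℕ => Encodable.encode t.reverse) wellFounded_lt
  have hinj : Function.Injective fun t : List ℕ => Encodable.encode t.reverse :=
    Encodable.encode_injective.comp List.reverse_injective
  obtain ⟨f, hf⟩ := hwf.exists_fun_of_forall_exists (β := α)
    (fun t g y => (∀ s hs, g s hs ≠ y) ∧ ∀ s m, (e : t = s ++ [m]) →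
      R s m (g s (e ▸ s.encode_reverse_lt_encode_reverse_append_singleton m)) y) fun t g => by
    have : Finite {s : List ℕ | Encodable.encode s.reverse < Encodable.encode t.reverse} :=
      Set.Finite.of_injOn (f := fun s : List ℕ => Encodable.encode s.reverse)
        (fun _ hs => hs) hinj.injOn (Set.finite_Iio (Encodable.encode t.reverse))
    have hfin := Set.finite_range fun s :
      {s : List ℕ | Encodable.encode s.reverse < Encodable.encode t.reverse} => g s s.2
    rcases t.eq_nil_or_concat' with rfl | ⟨s, m, rfl⟩
    · exact ⟨Classical.arbitrary α, fun s hs => absurd hs (Nat.not_lt_zero _), fun s m e => by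
        simp at e⟩
    · obtain ⟨y, hy, hy'⟩ := (hR s m (g s
        (s.encode_reverse_lt_encode_reverse_append_singleton m))).exists_notMem_finite hfin
      refine ⟨y, fun s hs e => hy' ⟨⟨s, hs⟩, e⟩, fun s' m' e => ?_⟩
      obtain ⟨rfl, e'⟩ := List.append_inj' e rfl
      obtain rfl := List.singleton_injective e'
      exact hy
  refine ⟨f, fun s t hst => ?_, fun t m => (hf (t ++ [m])).2 t m rfl⟩
  by_contra hne
  rcases lt_or_gt_of_ne (hinj.ne hne) with h | h
  · exact (hf t).1 s h hst
  · exact (hf s).1 t h hst.symm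

/-- Any orientation `T` of the everywhere `ω`-branching rooted tree (on vertex set
`ω^{<ω}`, with edges `{t, t ⌢ ⟨m⟩}`) embeds into every digraph with uncountable
dichromatic number. -/
theorem statement_5 (T : Digraph' (List ℕ)) (hverts : T.verts = Set.univ)
    (horient₁ : ∀ u v : List ℕ, T.Arc u v →
      (∃ m : ℕ, v = u ++ [m]) ∨ (∃ m : ℕ, u = v ++ [m]))
    (horient₂ : ∀ (t : List ℕ) (m : ℕ), T.Arc t (t ++ [m]) ∨ T.Arc (t ++ [m]) t)
    {V : Type*} (D : Digraph' V) (h : D.UncountableDichromatic) :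
    T.Embeds D := by
  obtain ⟨W, ⟨w₀, hw₀⟩, hW⟩ := h.exists_infinite_degrees
  have : Nonempty W := ⟨⟨w₀, hw₀⟩⟩
  obtain ⟨f, hinj, hf⟩ := exists_injective_of_infinite_children (α := W)
    (fun t m x y => (T.Arc t (t ++ [m]) → D.Arc x y) ∧ (T.Arc (t ++ [m]) t → D.Arc y x))
    fun t m x => by
      rcases horient₂ t m with ht | ht
      · intro hfin
        refine (hW x x.2).1 ((hfin.image Subtype.val).subset fun y hy => ?_)
        exact ⟨⟨y, hy.1⟩, ⟨fun _ => hy.2, fun h' => absurd h' (T.asymm' _ _ ht)⟩, rfl⟩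
      · intro hfin
        refine (hW x x.2).2 ((hfin.image Subtype.val).subset fun y hy => ?_)
        exact ⟨⟨y, hy.1⟩, ⟨fun h' => absurd h' (T.asymm' _ _ ht), fun _ => hy.2⟩, rfl⟩
  refine ⟨fun t => f t, fun s _ t _ hst => hinj (Subtype.ext hst), fun t _ => ?_,
    fun u v huv => ?_⟩
  · obtain ⟨w, -, hw⟩ := (hW (f t) (f t).2).1.nonempty
    exact D.arc_left hw
  · rcases horient₁ u v huv with ⟨m, rfl⟩ | ⟨m, rfl⟩
    · exact (hf u m).1 huv
    · exact (hf v m).2 huv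
end

section
/- Both ⃗H_{ω,ω} and ⃖H_{ω,ω} embed into every digraph D with uncountable dichromatic number. -/
/-- The orientation `⃗H_{ω,ω}` of the half graph: arcs `((k,0),(ℓ,1))` for `k ≤ ℓ`. -/
def forwardHalf : Digraph' (ℕ × Fin 2) where
  verts := Set.univ
  Arc u v := u.2 = 0 ∧ v.2 = 1 ∧ u.1 ≤ v.1
  arc_left := fun _ _ _ => Set.mem_univ _
  arc_right := fun _ _ _ => Set.mem_univ _
  irrefl' := by
    rintro v ⟨h0, h1, -⟩
    rw [h0] at h1
    exact absurd h1 (by decide)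
  asymm' := by
    rintro u v ⟨h0, -, -⟩ ⟨-, h1', -⟩
    rw [h0] at h1'
    exact absurd h1' (by decide)

/-- The orientation `⃖H_{ω,ω}` of the half graph: arcs `((ℓ,1),(k,0))` for `k ≤ ℓ`. -/
def backwardHalf : Digraph' (ℕ × Fin 2) where
  verts := Set.univ
  Arc u v := u.2 = 1 ∧ v.2 = 0 ∧ v.1 ≤ u.1
  arc_left := fun _ _ _ => Set.mem_univ _
  arc_right := fun _ _ _ => Set.mem_univ _
  irrefl' := by
    rintro v ⟨h0, h1, -⟩
    rw [h0] at h1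
    exact absurd h1 (by decide)
  asymm' := by
    rintro u v ⟨h0, -, -⟩ ⟨-, h1', -⟩
    rw [h0] at h1'
    exact absurd h1' (by decide)

namespace Digraph'

/-- The set `X` can be coloured with countably many colours, each colour class being acyclic. -/
def CountablyDicolorable {V : Type*} (D : Digraph' V) (X : Set V) : Prop :=
  ∃ c : V → ℕ, ∀ n, D.AcyclicSet {x | x ∈ X ∧ c x = n}

/-- The common out-neighbourhood of a finite set of vertices. -/
def commonOut {V : Type*} (D : Digraph' V) (F : Finset V) : Set V :=
  {w | ∀ y ∈ F, D.Arc y w}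

theorem AcyclicSet.mono {V : Type*} {D : Digraph' V} {A B : Set V} (hB : D.AcyclicSet B)
    (hAB : A ⊆ B) : D.AcyclicSet A :=
  fun m c hc => hB m c ⟨hc.1, hc.2.1, fun i => hAB (hc.2.2.1 i), hc.2.2.2⟩

theorem CountablyDicolorable.mono {V : Type*} {D : Digraph' V} {A B : Set V}
    (hB : D.CountablyDicolorable B) (hAB : A ⊆ B) : D.CountablyDicolorable A := by
  obtain ⟨c, hc⟩ := hB
  exact ⟨c, fun n => (hc n).mono fun x hx => ⟨hAB hx.1, hx.2⟩⟩

theorem acyclicSet_of_subsingleton {V : Type*} (D : Digraph' V) {A : Set V}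
    (hA : A.Subsingleton) : D.AcyclicSet A := by
  rintro m c ⟨-, -, hcA, hc⟩
  have h := hc 0
  rw [hA (hcA (0 + 1)) (hcA 0)] at h
  exact D.irrefl' _ h

theorem countablyDicolorable_of_countable {V : Type*} (D : Digraph' V) {X : Set V}
    (hX : X.Countable) : D.CountablyDicolorable X := by
  obtain ⟨c, hc⟩ := Set.countable_iff_exists_injOn.1 hX
  exact ⟨c, fun n => D.acyclicSet_of_subsingleton
    fun x hx y hy => hc hx.1 hy.1 (hx.2.trans hy.2.symm)⟩

/-- A function that is non-increasing along a directed cycle is constant on it. -/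
theorem cycle_const {ι : Type*} [LinearOrder ι] {m : ℕ} (hm : 1 ≤ m) (s : ZMod m → ι)
    (hs : ∀ i, s (i + 1) ≤ s i) (i j : ZMod m) : s i = s j := by
  have : NeZero m := ⟨by omega⟩
  have key : ∀ (i : ZMod m) (n : ℕ), s (i + n) ≤ s i := by
    intro i n
    induction n with
    | zero => simp
    | succ k ih =>
      have := hs (i + k)
      push_cast
      rw [← add_assoc]
      exact this.trans ih
  have le : ∀ i j : ZMod m, s j ≤ s i := by
    intro i j
    have := key i (j - i).val
    rwa [ZMod.natCast_zmod_val, add_sub_cancel] at this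
  exact le_antisymm (le j i) (le i j)

/-- If `S` is an infinite set of vertices all of whose finite nonempty subsets have infinitely
many common out-neighbours, then the forward half graph embeds. -/
theorem forwardHalf_embeds_of_infinite {V : Type*} (D : Digraph' V) (S : Set V)
    (hS : S.Infinite)
    (h : ∀ F : Finset V, F.Nonempty → (↑F : Set V) ⊆ S → (D.commonOut F).Infinite) :
    forwardHalf.Embeds D := by
  classical
  obtain ⟨f, hf, hr⟩ := exists_seq_of_forall_finset_exists
    (fun p : V × V => p.1 ∈ S ∧ D.Arc p.1 p.2)
    (fun p q => D.Arc p.1 q.2 ∧ q.1 ≠ p.1 ∧ q.1 ≠ p.2 ∧ q.2 ≠ p.2) (by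
      intro s hs
      obtain ⟨z, hzS, hz⟩ := hS.exists_notMem_finset (s.image Prod.fst ∪ s.image Prod.snd)
      obtain ⟨w, hwC, hw⟩ := (h (insert z (s.image Prod.fst)) (by simp) (by
        intro a ha
        simp only [Finset.coe_insert, Finset.coe_image, Set.mem_insert_iff, Set.mem_image,
          Finset.mem_coe] at ha
        rcases ha with rfl | ⟨p, hp, rfl⟩
        exacts [hzS, (hs p hp).1])).exists_notMem_finset (s.image Prod.snd)
      refine ⟨(z, w), ⟨hzS, hwC z (by simp)⟩, fun p hp => ⟨hwC p.1 ?_, ?_, ?_, ?_⟩⟩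
      · exact Finset.mem_insert_of_mem (Finset.mem_image_of_mem _ hp)
      · rintro rfl
        exact hz (Finset.mem_union_left _ (Finset.mem_image_of_mem _ hp))
      · rintro rfl
        exact hz (Finset.mem_union_right _ (Finset.mem_image_of_mem _ hp))
      · rintro rfl
        exact hw (Finset.mem_image_of_mem _ hp))
  have arc : ∀ k l, k ≤ l → D.Arc (f k).1 (f l).2 := by
    intro k l hkl
    rcases hkl.eq_or_lt with rfl | hlt
    exacts [(hf k).2, (hr k l hlt).1]
  have ne : ∀ k l, (f k).1 ≠ (f l).2 := by
    intro k l he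
    rcases le_or_gt k l with hkl | hlk
    · have := arc k l hkl
      rw [he] at this
      exact D.irrefl' _ this
    · exact (hr l k hlk).2.2.1 he
  have inj₁ : Function.Injective fun k => (f k).1 := by
    intro k l he
    rcases lt_trichotomy k l with hkl | hkl | hkl
    exacts [((hr k l hkl).2.1 he.symm).elim, hkl, ((hr l k hkl).2.1 he).elim]
  have inj₂ : Function.Injective fun k => (f k).2 := by
    intro k l he
    rcases lt_trichotomy k l with hkl | hkl | hkl
    exacts [((hr k l hkl).2.2.2 he.symm).elim, hkl, ((hr l k hkl).2.2.2 he).elim]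
  refine ⟨fun p => if p.2 = 0 then (f p.1).1 else (f p.1).2, ?_, ?_, ?_⟩
  · rintro ⟨k, a⟩ - ⟨l, b⟩ - he
    fin_cases a <;> fin_cases b <;> simp at he ⊢
    · exact inj₁ he
    · exact (ne _ _ he).elim
    · exact (ne _ _ he.symm).elim
    · exact inj₂ he
  · rintro ⟨k, a⟩ -
    fin_cases a
    · exact D.arc_left (hf k).2
    · exact D.arc_right (hf k).2
  · rintro ⟨k, a⟩ ⟨l, b⟩ ⟨ha, hb, hkl⟩
    dsimp only at ha hb hkl
    subst ha hb
    simpa using arc k l hkl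

/-- If every vertex has only finitely many relevant predecessors, there is an `ℕ`-valued
colouring separating each vertex from them. -/
theorem exists_coloring_of_finite {V : Type*} {ι : Type*} [LinearOrder ι] [WellFoundedLT ι]
    (r : V → ι) (P : V → Set V) (hP : ∀ x, (P x).Finite) (hlt : ∀ x, ∀ u ∈ P x, r u < r x) :
    ∃ f : V → ℕ, ∀ x, ∀ u ∈ P x, f u ≠ f x := by
  classical
  have step : ∀ x (g : ∀ u, r u < r x → ℕ), ∃ n, ∀ u (hu : u ∈ P x), g u (hlt x u hu) ≠ n := by
    intro x g
    have := (hP x).to_subtype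
    obtain ⟨n, hn⟩ := (Set.finite_range fun u : P x => g u (hlt x u u.2)).exists_notMem
    exact ⟨n, fun u hu he => hn ⟨⟨u, hu⟩, he⟩⟩
  choose G hG using step
  have wf : WellFounded fun u x => r u < r x := InvImage.wf r wellFounded_lt
  refine ⟨wf.fix G, fun x u hu => ?_⟩
  rw [wf.fix_eq G x]
  exact hG x (fun u _ => wf.fix G u) u hu

/-- Countable dicolourability passes from the levels of a suitable rank function to the
whole set, unless the forward half graph embeds. -/
theorem countablyDicolorable_of_rank {V : Type*} {ι : Type*} [LinearOrder ι] [WellFoundedLT ι]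
    (D : Digraph' V) (hD : ¬ forwardHalf.Embeds D) (X : Set V) (r : V → ι)
    (hr : ∀ F : Finset V, F.Nonempty → (↑F : Set V) ⊆ X → (D.commonOut F).Finite →
      ∀ w ∈ D.commonOut F ∩ X, ∃ y ∈ F, r w ≤ r y)
    (hlevel : ∀ a, D.CountablyDicolorable {x | x ∈ X ∧ r x = a}) :
    D.CountablyDicolorable X := by
  choose g hg using hlevel
  obtain ⟨f, hf⟩ := exists_coloring_of_finite r
    (fun x => {u | x ∈ X ∧ u ∈ X ∧ D.Arc u x ∧ r u < r x}) (by
      intro x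
      by_contra hinf
      refine hD (D.forwardHalf_embeds_of_infinite _ hinf fun F hF hFS => fun hfin => ?_)
      obtain ⟨y₀, hy₀⟩ := hF
      obtain ⟨y, hy, hle⟩ := hr F ⟨y₀, hy₀⟩ (fun y hy => (hFS hy).2.1) hfin x
        ⟨fun y hy => (hFS hy).2.2.1, (hFS hy₀).1⟩
      exact absurd (hFS hy).2.2.2 hle.not_gt) (fun x u hu => hu.2.2.2)
  refine ⟨fun x => Nat.pair (g (r x) x) (f x), ?_⟩
  rintro n m c ⟨hm, hinj, hmem, harc⟩
  have hpair : ∀ i j, g (r (c i)) (c i) = g (r (c j)) (c j) ∧ f (c i) = f (c j) :=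
    fun i j => Nat.pair_eq_pair.1 ((hmem i).2.trans (hmem j).2.symm)
  have hconst := cycle_const hm (fun i => r (c i)) fun i => by
    by_contra hlt
    exact hf (c (i + 1)) (c i) ⟨(hmem _).1, (hmem _).1, harc i, not_le.1 hlt⟩ (hpair _ _).2
  refine hg (r (c 0)) (g (r (c 0)) (c 0)) m c ⟨hm, hinj, fun i => ⟨⟨(hmem i).1, hconst i 0⟩, ?_⟩,
    harc⟩
  have h₁ := (hpair i 0).1
  have h₂ : r (c i) = r (c 0) := hconst i 0
  rwa [h₂] at h₁

/-- Closed under finite common out-neighbourhoods of finite nonempty subsets. -/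
def OutClosed {V : Type*} (D : Digraph' V) (M : Set V) : Prop :=
  ∀ F : Finset V, F.Nonempty → (↑F : Set V) ⊆ M → (D.commonOut F).Finite → D.commonOut F ⊆ M

/-- The least `OutClosed` set containing `A`. -/
def outClosure {V : Type*} (D : Digraph' V) (A : Set V) : Set V :=
  ⋂₀ {M | A ⊆ M ∧ D.OutClosed M}

theorem subset_outClosure {V : Type*} (D : Digraph' V) (A : Set V) : A ⊆ D.outClosure A :=
  fun _ hx _ hM => hM.1 hx

theorem outClosure_mono {V : Type*} (D : Digraph' V) {A B : Set V} (h : A ⊆ B) :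
    D.outClosure A ⊆ D.outClosure B :=
  fun _ hx M hM => hx M ⟨h.trans hM.1, hM.2⟩

theorem outClosed_outClosure {V : Type*} (D : Digraph' V) (A : Set V) :
    D.OutClosed (D.outClosure A) :=
  fun F hF hFA hfin _ hx M hM =>
    hM.2 F hF (fun _ hy => hFA hy M hM) hfin hx

/-- One step of the construction of the closure from below. -/
def outStep {V : Type*} (D : Digraph' V) (A : Set V) : Set V :=
  A ∪ ⋃ F : {F : Finset A // (D.commonOut (F.map (Function.Embedding.subtype _))).Finite},
    D.commonOut (F.1.map (Function.Embedding.subtype _))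

open Cardinal in
theorem mk_outStep_le {V : Type*} (D : Digraph' V) {A : Set V} {κ : Cardinal}
    (hκ : ℵ₀ ≤ κ) (hA : #A ≤ κ) : #(D.outStep A) ≤ κ := by
  refine (mk_union_le _ _).trans (add_le_of_le hκ hA ?_)
  refine (mk_iUnion_le _).trans (mul_le_of_le hκ ?_ (ciSup_le' fun F => ?_))
  · refine (mk_subtype_le _).trans ?_
    rcases finite_or_infinite A with hfin | hinf
    · exact (mk_le_aleph0).trans hκ
    · rwa [mk_finset_of_infinite]
  · exact (F.2.lt_aleph0.le).trans hκ

open Cardinal in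
theorem mk_outClosure_le {V : Type*} (D : Digraph' V) {A : Set V} {κ : Cardinal}
    (hκ : ℵ₀ ≤ κ) (hA : #A ≤ κ) : #(D.outClosure A) ≤ κ := by
  classical
  set T : ℕ → Set V := fun n => D.outStep^[n] A
  have hsucc : ∀ n, T (n + 1) = D.outStep (T n) := fun n => Function.iterate_succ_apply' _ _ _
  have hmono : Monotone T := monotone_nat_of_le_succ fun n => by
    rw [hsucc]
    exact Set.subset_union_left
  have hcard : ∀ n, #(T n) ≤ κ := by
    intro n
    induction n with
    | zero => exact hA
    | succ n ih =>
      rw [hsucc]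
      exact D.mk_outStep_le hκ ih
  have hsub : D.outClosure A ⊆ ⋃ n : ULift ℕ, T n.down := by
    refine Set.sInter_subset_of_mem ⟨fun x hx => Set.mem_iUnion.2 ⟨⟨0⟩, hx⟩, ?_⟩
    intro F _ hFT hfin x hx
    choose! k hk using fun y (hy : y ∈ F) => Set.mem_iUnion.1 (hFT hy)
    have hFn : ∀ y ∈ F, y ∈ T (F.sup fun y => (k y).down) := fun y hy =>
      hmono (Finset.le_sup (f := fun y => (k y).down) hy) (hk y hy)
    refine Set.mem_iUnion.2 ⟨⟨(F.sup fun y => (k y).down) + 1⟩, ?_⟩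
    rw [hsucc]
    have hFeq : (F.subtype (· ∈ T (F.sup fun y => (k y).down))).map
        (Function.Embedding.subtype _) = F := Finset.subtype_map_of_mem hFn
    refine Or.inr (Set.mem_iUnion.2 ⟨⟨F.subtype _, ?_⟩, ?_⟩)
    · rwa [hFeq]
    · rwa [hFeq]
  refine (mk_le_mk_of_subset hsub).trans ((mk_iUnion_le _).trans
    (mul_le_of_le hκ (mk_le_aleph0.trans hκ) (ciSup_le' fun n => hcard _)))

open Cardinal in
/-- If the forward half graph does not embed, then every vertex set is countably
dicolourable. -/
theorem countablyDicolorable_of_not_embeds {V : Type*} (D : Digraph' V)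
    (hD : ¬ forwardHalf.Embeds D) (X : Set V) : D.CountablyDicolorable X := by
  induction hκ : #X using WellFoundedLT.induction generalizing X with
  | ind κ ih =>
  rcases le_or_gt κ ℵ₀ with hle | hlt
  · exact D.countablyDicolorable_of_countable (by rwa [← le_aleph0_iff_set_countable, hκ])
  classical
  obtain ⟨e⟩ : Nonempty (κ.ord.ToType ≃ X) := Cardinal.eq.1 (by rw [hκ, mk_ord_toType])
  set M : κ.ord.ToType → Set V := fun a =>
    D.outClosure ((fun b => (e b : V)) '' Set.Iic a)
  have hMmono : Monotone M := fun a b hab =>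
    D.outClosure_mono (Set.image_mono (Set.Iic_subset_Iic.2 hab))
  have hMcard : ∀ a, #(M a) < κ := by
    intro a
    have hIic : #(Set.Iic a) < κ := by
      rw [← Set.Iio_insert]
      refine mk_insert_le.trans_lt (add_lt_of_lt hlt.le
        ((mk_Iio_lt a (by simp)).trans_eq (mk_ord_toType κ)) ?_)
      exact one_lt_aleph0.trans hlt
    refine (D.mk_outClosure_le (le_max_left ℵ₀ #(Set.Iic a))
      (mk_image_le.trans (le_max_right _ _))).trans_lt (max_lt hlt hIic)
  have hne : Nonempty κ.ord.ToType := by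
    rw [← mk_ne_zero_iff, mk_ord_toType]
    exact (aleph0_pos.trans hlt).ne'
  have hrank : ∀ x, ∃ a, x ∈ X → x ∈ M a ∧ ∀ b, x ∈ M b → a ≤ b := by
    intro x
    by_cases hx : x ∈ X
    · have hex : {a | x ∈ M a}.Nonempty :=
        ⟨e.symm ⟨x, hx⟩, D.subset_outClosure _ ⟨e.symm ⟨x, hx⟩, Set.self_mem_Iic, by simp⟩⟩
      have wf : WellFounded ((· < ·) : κ.ord.ToType → κ.ord.ToType → Prop) := wellFounded_lt
      exact ⟨wf.min _ hex, fun _ => ⟨wf.min_mem _ hex, fun b hb => wf.min_le hb⟩⟩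
    · exact ⟨hne.some, fun h => (hx h).elim⟩
  choose r hr using hrank
  refine D.countablyDicolorable_of_rank hD X r ?_ ?_
  · intro F hF hFX hfin w hw
    obtain ⟨y, hy, hmax⟩ := F.exists_max_image r hF
    exact ⟨y, hy, (hr w hw.2).2 _ (D.outClosed_outClosure _ F hF
      (fun z hz => hMmono (hmax z hz) (hr z (hFX hz)).1) hfin hw.1)⟩
  · intro a
    refine (ih _ (hMcard a) (M a) rfl).mono ?_
    rintro x ⟨hx, rfl⟩
    exact (hr x hx).1

theorem UncountableDichromatic.forwardHalf_embeds {V : Type*} {D : Digraph' V}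
    (h : D.UncountableDichromatic) : forwardHalf.Embeds D := by
  by_contra hD
  obtain ⟨c, hc⟩ := D.countablyDicolorable_of_not_embeds hD D.verts
  exact h ⟨_, hc, fun x hx => Set.mem_iUnion.2 ⟨c x, hx, rfl⟩⟩

theorem AcyclicSet.of_rev {V : Type*} {D : Digraph' V} {A : Set V}
    (hA : D.rev.AcyclicSet A) : D.AcyclicSet A := by
  rintro m c ⟨hm, hinj, hmem, harc⟩
  refine hA m (fun i => c (-i)) ⟨hm, fun i j hij => neg_injective (hinj hij),
    fun i => hmem _, fun i => ?_⟩
  have := harc (-(i + 1))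
  rwa [show -(i + 1) + 1 = -i by ring] at this

theorem UncountableDichromatic.rev {V : Type*} {D : Digraph' V}
    (h : D.UncountableDichromatic) : D.rev.UncountableDichromatic :=
  fun ⟨F, hF, hcov⟩ => h ⟨F, fun n => (hF n).of_rev, hcov⟩

end Digraph'

/-- Both orientations `⃗H_{ω,ω}` and `⃖H_{ω,ω}` of the half graph embed into every
digraph with uncountable dichromatic number. -/
theorem statement_7 {V : Type*} (D : Digraph' V) (h : D.UncountableDichromatic) :
    forwardHalf.Embeds D ∧ backwardHalf.Embeds D := by
  refine ⟨h.forwardHalf_embeds, ?_⟩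
  obtain ⟨f, hinj, hmaps, harc⟩ := h.rev.forwardHalf_embeds
  exact ⟨f, hinj, hmaps, fun u v huv => harc ⟨huv.2.1, huv.1, huv.2.2⟩⟩
end

section
/- Suppose 𝕊 is a Suslin tree and G_𝕊 is its comparability graph, i.e., the undirected graph on vertex set 𝕊 with an edge {s,t} whenever s <_𝕊 t or t <_𝕊 s. Then there is an orientation D of G_𝕊 such that for every uncountable set T ⊆ 𝕊 and every integer n ≥ 3, the directed cycle ⃗C_n embeds into the induced subdigraph D[T]. -/
/-- The tree axioms together with the absence of uncountable chains and antichains. -/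
structure IsSuslinTree (S : Type*) [PartialOrder S] : Prop where
  pred_chain : ∀ t : S, IsChain (· ≤ ·) (Set.Iio t)
  pred_wf : ∀ t : S, (Set.Iio t).IsWF
  chain_countable : ∀ C : Set S, IsChain (· ≤ ·) C → C.Countable
  antichain_countable : ∀ A : Set S, IsAntichain (· ≤ ·) A → A.Countable

theorem exists_uncountable_fiber {α ι : Type*} [Countable ι] {T : Set α} (hT : ¬ T.Countable)
    (P : ι → α → Prop) (h : ∀ a ∈ T, ∃ i, P i a) : ∃ i, ¬ {a ∈ T | P i a}.Countable := by
  by_contra! hc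
  refine hT ((Set.countable_iUnion hc).mono fun a ha => ?_)
  obtain ⟨i, hi⟩ := h a ha
  exact Set.mem_iUnion.2 ⟨i, ha, hi⟩

theorem exists_countable_closed {α : Type*} {M₀ : Set α} (hM₀ : M₀.Countable) {K : α → Set α}
    (hK : ∀ a, (K a).Countable) :
    ∃ M : Set α, M₀ ⊆ M ∧ M.Countable ∧ ∀ a ∈ M, K a ⊆ M := by
  let F : ℕ → Set α := fun n => Nat.rec M₀ (fun _ A => A ∪ ⋃ a ∈ A, K a) n
  have hF : ∀ n, (F n).Countable := by
    intro n
    induction n with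
    | zero => exact hM₀
    | succ n ih => exact ih.union (ih.biUnion fun a _ => hK a)
  refine ⟨⋃ n, F n, Set.subset_iUnion F 0, Set.countable_iUnion hF, fun a ha b hb => ?_⟩
  obtain ⟨n, hn⟩ := Set.mem_iUnion.1 ha
  exact Set.mem_iUnion.2 ⟨n + 1, Or.inr (Set.mem_iUnion₂.2 ⟨a, hn, hb⟩)⟩

namespace List

/-- A new vertex can be inserted into a directed path of a tournament. -/
theorem exists_perm_cons_isChain {α : Type*} {R : α → α → Prop} (v : α) (l : List α)
    (hl : l.IsChain R) (hv : ∀ w ∈ l, R v w ∨ R w v) :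
    ∃ l' : List α, l'.Perm (v :: l) ∧ l'.IsChain R ∧ (l'.head? = some v ∨ l'.head? = l.head?) := by
  induction l with
  | nil => exact ⟨[v], .refl _, by simp, by simp⟩
  | cons a l ih =>
    rcases hv a (by simp) with h | h
    · exact ⟨v :: a :: l, .refl _, List.isChain_cons_cons.2 ⟨h, hl⟩, by simp⟩
    · obtain ⟨l', hp, hc, hh⟩ := ih hl.tail fun w hw => hv w (by simp [hw])
      refine ⟨a :: l', (hp.cons a).trans (.swap _ _ _), ?_, by simp⟩
      rw [List.isChain_cons]
      refine ⟨fun b hb => ?_, hc⟩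
      rcases hh with hh | hh
      · rw [hh] at hb
        simp only [Option.mem_def, Option.some.injEq] at hb
        exact hb ▸ h
      · rw [hh] at hb
        exact (List.isChain_cons.1 hl).1 b hb

/-- Every finite tournament has a Hamiltonian path. -/
theorem exists_perm_isChain {α : Type*} {R : α → α → Prop} (l : List α)
    (hl : l.Pairwise fun a b => R a b ∨ R b a) :
    ∃ l' : List α, l'.Perm l ∧ l'.IsChain R := by
  induction l with
  | nil => exact ⟨[], .refl _, by simp⟩
  | cons a l ih =>
    rw [List.pairwise_cons] at hl
    obtain ⟨l', hp, hc⟩ := ih hl.2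
    obtain ⟨l'', hp', hc', -⟩ :=
      exists_perm_cons_isChain a l' hc fun w hw => hl.1 w (hp.subset hw)
    exact ⟨l'', hp'.trans (hp.cons a), hc'⟩

end List

namespace IsSuslinTree

variable {S : Type*} [PartialOrder S]

theorem wellFounded (hS : IsSuslinTree S) : WellFounded ((· < ·) : S → S → Prop) := by
  rw [WellFounded.wellFounded_iff_has_min]
  rintro A ⟨a, ha⟩
  by_cases h : (A ∩ Set.Iio a).Nonempty
  · have hwf : (A ∩ Set.Iio a).IsWF := (hS.pred_wf a).mono Set.inter_subset_right
    refine ⟨hwf.min h, (hwf.min_mem h).1, fun x hx hlt => ?_⟩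
    exact hwf.not_lt_min h ⟨hx, hlt.trans (hwf.min_mem h).2⟩ hlt
  · exact ⟨a, ha, fun x hx hlt => h ⟨x, hx, hlt⟩⟩

theorem exists_minimal_le (hS : IsSuslinTree S) {A : Set S} {a : S} (ha : a ∈ A) :
    ∃ b, Minimal (· ∈ A) b ∧ b ≤ a := by
  obtain ⟨b, hb, hmin⟩ := hS.wellFounded.has_min (A ∩ Set.Iic a) ⟨a, ha, le_rfl⟩
  refine ⟨b, ⟨hb.1, fun c hc hcb => ?_⟩, hb.2⟩
  by_contra hn
  exact hmin c ⟨hc, hcb.trans hb.2⟩ (lt_of_le_not_ge hcb hn)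

theorem countable_minimal (hS : IsSuslinTree S) (A : Set S) :
    {b | Minimal (· ∈ A) b}.Countable :=
  hS.antichain_countable _ (setOfPred_minimal_antichain _)

theorem le_total_of_le (hS : IsSuslinTree S) {a b c : S} (ha : a ≤ c) (hb : b ≤ c) :
    a ≤ b ∨ b ≤ a := by
  rcases ha.eq_or_lt with rfl | ha
  · exact Or.inr hb
  rcases hb.eq_or_lt with rfl | hb
  · exact Or.inl ha.le
  exact (hS.pred_chain c).total ha hb

theorem countable_Iio (hS : IsSuslinTree S) (t : S) : (Set.Iio t).Countable :=
  hS.chain_countable _ (hS.pred_chain t)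

theorem countable_Iic (hS : IsSuslinTree S) (t : S) : (Set.Iic t).Countable := by
  rw [← Set.Iio_union_right]
  exact (hS.countable_Iio t).union (Set.countable_singleton t)

/-- All but countably many nodes have uncountably many successors. -/
theorem countable_setOf_countable_Ici (hS : IsSuslinTree S) :
    {x : S | (Set.Ici x).Countable}.Countable := by
  set A := {x : S | (Set.Ici x).Countable}
  refine ((hS.countable_minimal A).biUnion (t := fun b _ => Set.Ici b)
    fun b hb => hb.prop).mono fun a ha => ?_
  obtain ⟨b, hb, hba⟩ := hS.exists_minimal_le ha
  exact Set.mem_iUnion₂.2 ⟨b, hb, hba⟩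

/-- Every uncountable set is dense above some node. -/
theorem exists_dense_above (hS : IsSuslinTree S) {T : Set S} (hT : ¬ T.Countable) :
    ∃ q : S, ¬ (Set.Ici q).Countable ∧
      ∀ x, q ≤ x → ¬ (Set.Ici x).Countable → ¬ (T ∩ Set.Ici x).Countable := by
  by_contra! hc
  set B := {x : S | ¬ (Set.Ici x).Countable ∧ (T ∩ Set.Ici x).Countable}
  refine hT (((hS.countable_setOf_countable_Ici.union
    ((hS.countable_minimal B).biUnion (t := fun b _ => T ∩ Set.Ici b)
      fun b hb => hb.prop.2)).union
    ((hS.countable_minimal B).biUnion (t := fun b _ => Set.Iic b)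
      fun b _ => hS.countable_Iic b)).mono fun q hq => ?_)
  by_cases hqc : (Set.Ici q).Countable
  · exact Or.inl (Or.inl hqc)
  obtain ⟨x, hqx, hx⟩ := hc q hqc
  obtain ⟨b, hb, hbx⟩ := hS.exists_minimal_le (A := B) hx
  rcases hS.le_total_of_le hqx hbx with h | h
  · exact Or.inr (Set.mem_iUnion₂.2 ⟨b, hb, h⟩)
  · exact Or.inl (Or.inr (Set.mem_iUnion₂.2 ⟨b, hb, hq, h⟩))

theorem exists_uncountable_above (hS : IsSuslinTree S) {T : Set S} (hT : ¬ T.Countable) :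
    ∃ t ∈ T, ¬ (T ∩ Set.Ioi t).Countable := by
  obtain ⟨q, hq, hd⟩ := hS.exists_dense_above hT
  obtain ⟨t, ⟨ht, hqt⟩, htc⟩ := Set.nonempty_of_not_subset fun h0 =>
    hd q le_rfl hq (hS.countable_setOf_countable_Ici.mono h0)
  refine ⟨t, ht, fun hc => hd t hqt htc ?_⟩
  refine (hc.union (Set.countable_singleton t)).mono fun x hx => ?_
  rcases (show t ≤ x from hx.2).eq_or_lt with rfl | h
  · exact Or.inr rfl
  · exact Or.inl ⟨hx.1, h⟩

/-- Uncountable sets contain finite chains of any length. -/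
theorem exists_chain_length (hS : IsSuslinTree S) (m : ℕ) {T : Set S} (hT : ¬ T.Countable) :
    ∃ l : List S, l.length = m ∧ l.Pairwise (· < ·) ∧ (∀ a ∈ l, a ∈ T) ∧
      ∃ v, ∀ a ∈ l, a ≤ v := by
  induction m generalizing T with
  | zero =>
    obtain ⟨t, -⟩ := hS.exists_uncountable_above hT
    exact ⟨[], rfl, by simp, by simp, t, by simp⟩
  | succ m ih =>
    obtain ⟨t, ht, hu⟩ := hS.exists_uncountable_above hT
    obtain ⟨l, hlen, hlt, hlT, v, hv⟩ := ih hu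
    refine ⟨t :: l, by simp [hlen], List.pairwise_cons.2 ⟨fun a ha => (hlT a ha).2, hlt⟩,
      ?_, ?_⟩
    · simpa [ht] using fun a ha => (hlT a ha).1
    · cases l with
      | nil => exact ⟨t, by simp⟩
      | cons b l =>
        refine ⟨v, List.forall_mem_cons.2 ⟨?_, hv⟩⟩
        exact (show t < b from (hlT b (by simp)).2).le.trans (hv b (by simp))

/-- Above a node with uncountable cone there are two incomparable such nodes. -/
theorem exists_split (hS : IsSuslinTree S) {r : S} (hr : ¬ (Set.Ici r).Countable) :
    ∃ z w : S, r < z ∧ r < w ∧ ¬ (Set.Ici z).Countable ∧ ¬ (Set.Ici w).Countable ∧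
      ∀ c, z ≤ c → ¬ w ≤ c := by
  by_contra! hc
  set A := {x : S | r < x ∧ ¬ (Set.Ici x).Countable}
  have hA : IsChain (· ≤ ·) A := by
    intro z hz w hw _
    obtain ⟨c, hzc, hwc⟩ := hc z w hz.1 hw.1 hz.2 hw.2
    exact hS.le_total_of_le hzc hwc
  refine hr ((((hS.chain_countable A hA).union hS.countable_setOf_countable_Ici).union
    (Set.countable_singleton r)).mono fun x hx => ?_)
  rcases (show r ≤ x from hx).eq_or_lt with rfl | h
  · exact Or.inr rfl
  · by_cases hx' : (Set.Ici x).Countable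
    · exact Or.inl (Or.inr hx')
    · exact Or.inl (Or.inl ⟨h, hx'⟩)

/-- A real-valued labelling that separates comparable nodes. -/
theorem exists_real_label (hS : IsSuslinTree S) : ∃ x : S → ℝ, ∀ a c, a < c → x a ≠ x c := by
  have key : ∀ (t : S) (g : ∀ s, s < t → ℝ), ∃ z : ℝ, ∀ s hs, g s hs ≠ z := by
    intro t g
    have : Countable (Set.Iio t) := (hS.countable_Iio t).to_subtype
    have hc := Set.countable_range fun s : Set.Iio t => g s s.2
    obtain ⟨z, hz⟩ := (Set.ne_univ_iff_exists_notMem _).1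
      fun h => Cardinal.not_countable_real (h ▸ hc)
    exact ⟨z, fun s hs h => hz ⟨⟨s, hs⟩, h⟩⟩
  refine ⟨hS.wellFounded.fix fun t g => (key t g).choose, fun a c hac => ?_⟩
  rw [hS.wellFounded.fix_eq _ c]
  exact (key c fun s _ => hS.wellFounded.fix (fun t g => (key t g).choose) s).choose_spec a hac

end IsSuslinTree

/-- The list `l` is a directed path on `m` vertices of `T`. -/
structure IsPathIn {S : Type*} (E : S → S → Prop) (T : Set S) (m : ℕ) (l : List S) : Prop where
  length_eq : l.length = m
  nodup : l.Nodup
  isChain : l.IsChain E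
  mem : ∀ a ∈ l, a ∈ T

/-- The node selected by the pair `a < c`: the least `r` strictly between them whose index
`e c r` is small compared with the distance of the labels of `a` and `c`. -/
def IsSelected {S : Type*} [PartialOrder S] (e : S → S → ℕ) (x : S → ℝ) (a c r : S) : Prop :=
  a < r ∧ r < c ∧ (e c r : ℝ) * |x a - x c| < 1 ∧
    ∀ g, a < g → g < r → ¬ (e c g : ℝ) * |x a - x c| < 1

namespace IsSuslinTree

variable {S : Type*} [PartialOrder S]

theorem isSelected_unique (hS : IsSuslinTree S) {e : S → S → ℕ} {x : S → ℝ} {a c r r' : S}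
    (h : IsSelected e x a c r) (h' : IsSelected e x a c r') : r = r' := by
  rcases hS.le_total_of_le h.2.1.le h'.2.1.le with hle | hle
  · rcases hle.eq_or_lt with rfl | hlt
    · rfl
    · exact absurd h.2.2.1 (h'.2.2.2 r h.1 hlt)
  · rcases hle.eq_or_lt with rfl | hlt
    · rfl
    · exact absurd h'.2.2.1 (h.2.2.2 r' h'.1 hlt)

/-- A node that reflects countably many kinds of events: an event seen strictly above `r`
is also seen in every final segment of the predecessors of `r`. -/
theorem exists_reflecting (hS : IsSuslinTree S) {ι : Type*} [Countable ι] (Q : ι → S → S → Prop)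
    {q : S} (hq : ¬ (Set.Ici q).Countable) :
    ∃ r, q < r ∧ ¬ (Set.Ici r).Countable ∧
      ∀ i, ∀ h < r, ∀ v, r ≤ v → Q i h v → ∃ v' < r, Q i h v' := by
  set K : S → Set S := fun h => ⋃ i, ⋃ b ∈ {b | Minimal (· ∈ {v | Q i h v}) b}, Set.Iic b
  have hK : ∀ h, (K h).Countable := fun h => Set.countable_iUnion fun i =>
    (hS.countable_minimal _).biUnion fun b _ => hS.countable_Iic b
  obtain ⟨M, hM₀, hM, hMK⟩ := exists_countable_closed (hS.countable_Iic q) hK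
  have hne : (Set.Ici q \ (M ∪ {x : S | (Set.Ici x).Countable})).Nonempty := by
    rw [Set.nonempty_iff_ne_empty]
    intro h0
    exact hq ((hM.union hS.countable_setOf_countable_Ici).mono (Set.sdiff_eq_empty.1 h0))
  obtain ⟨x, hqx, hx⟩ := hne
  rw [Set.mem_union, not_or] at hx
  obtain ⟨r, hr, hrx⟩ := hS.exists_minimal_le (A := Mᶜ) hx.1
  have hrc : ¬ (Set.Ici r).Countable := fun h => hx.2 (h.mono (Set.Ici_subset_Ici.2 hrx))
  have hqr : q < r := by
    rcases hS.le_total_of_le hqx hrx with h | h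
    · exact lt_of_le_of_ne h fun h => hr.prop (hM₀ h.ge)
    · exact absurd (hM₀ h) hr.prop
  refine ⟨r, hqr, hrc, fun i h hh v hrv hv => ?_⟩
  have hhM : h ∈ M := by
    by_contra hn
    exact absurd (hr.2 hn hh.le) (not_le_of_gt hh)
  obtain ⟨b, hb, hbv⟩ := hS.exists_minimal_le (A := {v | Q i h v}) hv
  refine ⟨b, ?_, hb.prop⟩
  have hrb : ¬ r ≤ b := fun hrb =>
    hr.prop (hMK h hhM (Set.mem_iUnion.2 ⟨i, Set.mem_iUnion₂.2 ⟨b, hb, hrb⟩⟩))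
  rcases hS.le_total_of_le hbv hrv with h1 | h1
  · exact lt_of_le_of_ne h1 fun h2 => hrb h2.ge
  · exact absurd h1 hrb

/-- In an uncountable set, all but countably many labels are approximated from above. -/
theorem exists_uncountable_right_accumulating (hS : IsSuslinTree S) {y : S → ℝ}
    (hy : ∀ a c, a < c → y a ≠ y c) {T : Set S} (hT : ¬ T.Countable) :
    ∃ T' ⊆ T, ¬ T'.Countable ∧ ∀ u ∈ T', ∀ s : ℝ, y u < s → ∃ c ∈ T, y u < y c ∧ y c < s := by
  set U : ℚ → Set S := fun p => {u ∈ T | y u < p ∧ ∀ c ∈ T, y u < y c → ¬ y c < p}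
  have hUc : ∀ p, (U p).Countable := by
    intro p
    apply hS.antichain_countable
    intro a ha b hb hab hle
    have hne := hy a b (lt_of_le_of_ne hle hab)
    rcases lt_or_gt_of_ne hne with h | h
    · exact ha.2.2 b hb.1 h hb.2.1
    · exact hb.2.2 a ha.1 h ha.2.1
  refine ⟨T \ ⋃ p, U p, Set.sdiff_subset, fun hc => hT ?_, fun u hu s hs => ?_⟩
  · refine (hc.union (Set.countable_iUnion hUc)).mono fun a ha => ?_
    by_cases h : a ∈ ⋃ p, U p
    · exact Or.inr h
    · exact Or.inl ⟨ha, h⟩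
  · obtain ⟨p, hup, hps⟩ := exists_rat_btwn hs
    by_contra! hc
    refine hu.2 (Set.mem_iUnion.2 ⟨p, hu.1, hup, fun c hcT h1 h2 => ?_⟩)
    exact absurd (hc c hcT h1) (not_le_of_gt (h2.trans hps))

/-- If every uncountable subset of `T` has a bounded path with increasing end labels, then
such a path closes up to a directed cycle in `T`. -/
theorem exists_cycle_of_paths (hS : IsSuslinTree S) {E : S → S → Prop} {y : S → ℝ}
    (hy : ∀ a c, a < c → y a ≠ y c) {e : S → S → ℕ} (he : ∀ c, Set.InjOn (e c) (Set.Iio c))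
    {z : S → S} (hz : ∀ r, ¬ (Set.Ici r).Countable → r < z r ∧ ¬ (Set.Ici (z r)).Countable)
    (hE : ∀ a c r, IsSelected e y a c r → ¬ (Set.Ici r).Countable → z r ≤ c →
      (y a < y c → E c a) ∧ (y c < y a → E a c))
    {T : Set S} (hT : ¬ T.Countable) {m : ℕ}
    (hpath : ∀ T' ⊆ T, ¬ T'.Countable → ∃ l a b v, IsPathIn E T' m l ∧ l.head? = some a ∧
      l.getLast? = some b ∧ (∀ w ∈ l, w ≤ v) ∧ y a < y b) :
    ∃ l a b, IsPathIn E T (m + 1) l ∧ l.head? = some a ∧ l.getLast? = some b ∧ E b a := by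
  obtain ⟨q, hq, hd⟩ := hS.exists_dense_above hT
  obtain ⟨r, hqr, hr, hrefl⟩ := hS.exists_reflecting
    (fun (i : ℚ × ℚ × ℚ × ℚ) (h v : S) => ∃ l a b, IsPathIn E T m l ∧ l.head? = some a ∧
      l.getLast? = some b ∧ (∀ w ∈ l, h < w ∧ w ≤ v) ∧
      (i.1 < y a ∧ y a < i.2.1) ∧ (i.2.2.1 < y b ∧ y b < i.2.2.2)) hq
  obtain ⟨hrz, hzc⟩ := hz r hr
  have h1 := hd (z r) (hqr.trans hrz).le hzc
  obtain ⟨k, h2⟩ := exists_uncountable_fiber h1 (fun k c => e c r = k) fun c _ => ⟨_, rfl⟩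
  obtain ⟨p, h3⟩ := exists_uncountable_fiber h2
    (fun (p : ℚ × ℚ) c => (p.1 < y c ∧ y c < p.2) ∧ (k : ℝ) * (p.2 - p.1) < 1) (by
      intro c _
      have hpos : (0 : ℝ) < 1 / (4 * (k + 1)) := by positivity
      obtain ⟨p₁, h1, h1'⟩ := exists_rat_btwn (sub_lt_self (y c) hpos)
      obtain ⟨p₂, h2, h2'⟩ := exists_rat_btwn (lt_add_of_pos_right (y c) hpos)
      refine ⟨(p₁, p₂), ⟨h1', h2⟩, ?_⟩
      have hlt : (p₂ : ℝ) - p₁ ≤ 2 * (1 / (4 * (k + 1))) := by linarith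
      calc (k : ℝ) * (p₂ - p₁) ≤ k * (2 * (1 / (4 * (k + 1)))) := by gcongr
        _ < 1 := by
          field_simp
          linarith [(Nat.cast_nonneg k : (0 : ℝ) ≤ k)])
  set T₂ := {c ∈ {c ∈ T ∩ Set.Ici (z r) | e c r = k} |
    ((p.1 : ℝ) < y c ∧ y c < p.2) ∧ (k : ℝ) * (p.2 - p.1) < 1}
  obtain ⟨T₃, hT₃, hT₃c, hacc⟩ := hS.exists_uncountable_right_accumulating hy h3
  obtain ⟨l, a, b, v, hl, hla, hlb, hlv, hab⟩ :=
    hpath T₃ (hT₃.trans fun c hc => hc.1.1.1) hT₃c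
  have hal : a ∈ l := List.mem_of_mem_head? hla
  have hbl : b ∈ l := List.mem_of_mem_getLast? hlb
  obtain ⟨c, hc, hac, hcb⟩ := hacc a (hl.mem a hal) (y b) hab
  obtain ⟨s, has, hsc⟩ := exists_rat_btwn hac
  obtain ⟨t, hct, htb⟩ := exists_rat_btwn hcb
  have haT := hT₃ (hl.mem a hal)
  have hbT := hT₃ (hl.mem b hbl)
  have hrc : r < c := hrz.trans_le hc.1.1.2
  obtain ⟨d, hd0, hds, hdt⟩ : ∃ d : ℝ, 0 < d ∧ d ≤ y c - s ∧ d ≤ t - y c :=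
    ⟨min (y c - s) (t - y c), lt_min (by linarith) (by linarith), min_le_left _ _,
      min_le_right _ _⟩
  have hfin : {g | g < r ∧ (e c g : ℝ) * d < 1}.Finite := by
    refine Set.Finite.of_finite_image ((Set.finite_Iio (⌈1 / d⌉₊)).subset ?_)
      ((he c).mono fun g hg => hg.1.trans hrc)
    rintro _ ⟨g, hg, rfl⟩
    exact Nat.lt_ceil.2 ((lt_div_iff₀ hd0).2 hg.2)
  obtain ⟨h, hhr, hh⟩ : ∃ h < r, ∀ g < r, (e c g : ℝ) * d < 1 → g ≤ h := by
    obtain ⟨h, hmax⟩ := (hfin.insert q).exists_maximal (Set.insert_nonempty _ _)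
    have hlt : ∀ g ∈ insert q {g | g < r ∧ (e c g : ℝ) * d < 1}, g < r := by
      rintro g (rfl | hg)
      exacts [hqr, hg.1]
    refine ⟨h, hlt h hmax.prop, fun g hg hgd => ?_⟩
    rcases hS.le_total_of_le hg.le (hlt h hmax.prop).le with h' | h'
    · exact h'
    · exact hmax.2 (Or.inr ⟨hg, hgd⟩) h'
  have hrl : ∀ w ∈ l, r < w := fun w hw => hrz.trans_le (hT₃ (hl.mem w hw)).1.1.2
  obtain ⟨v', hv'r, l', a', b', hl', hla', hlb', hlv', ha', hb'⟩ :=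
    hrefl (p.1, s, t, p.2) h hhr v ((hrl a hal).le.trans (hlv a hal))
      ⟨l, a, b, ⟨hl.length_eq, hl.nodup, hl.isChain, fun w hw => (hT₃ (hl.mem w hw)).1.1.1⟩, hla,
        hlb, fun w hw => ⟨hhr.trans (hrl w hw), hlv w hw⟩, ⟨haT.2.1.1, has⟩, ⟨htb, hbT.2.1.2⟩⟩
  simp only at ha' hb'
  have hsel : ∀ w ∈ l', (p.1 : ℝ) < y w → y w < p.2 → d ≤ |y w - y c| → IsSelected e y w c r := by
    intro w hw hpw hwp hdw
    refine ⟨(hlv' w hw).2.trans_lt hv'r, hrc, ?_, fun g hwg hgr hg => ?_⟩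
    · rw [hc.1.2]
      refine lt_of_le_of_lt ?_ hc.2.2
      gcongr
      rw [abs_le]
      constructor <;> linarith [hc.2.1.1, hc.2.1.2]
    · have hgd : (e c g : ℝ) * d < 1 := lt_of_le_of_lt (by gcongr) hg
      exact absurd (hh g hgr hgd) (not_le_of_gt ((hlv' w hw).1.trans hwg))
  have ha'l : a' ∈ l' := List.mem_of_mem_head? hla'
  have hb'l : b' ∈ l' := List.mem_of_mem_getLast? hlb'
  have hsa := hsel a' ha'l ha'.1 (by linarith [hc.2.1.2, ha'.2])
    (by rw [abs_sub_comm]; exact le_trans (by linarith) (le_abs_self _))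
  have hsb := hsel b' hb'l (by linarith [hc.2.1.1, hb'.1]) hb'.2
    (le_trans (by linarith) (le_abs_self _))
  refine ⟨c :: l', c, b', ⟨by simp [hl'.length_eq], List.nodup_cons.2 ⟨fun hcl => ?_, hl'.nodup⟩,
    List.isChain_cons.2 ⟨fun w hw => ?_, hl'.isChain⟩,
    List.forall_mem_cons.2 ⟨hc.1.1.1, hl'.mem⟩⟩, rfl, ?_, ?_⟩
  · exact absurd ((hlv' c hcl).2.trans_lt hv'r) hrc.not_gt
  · rw [hla'] at hw
    obtain rfl := Option.some.inj hw
    exact (hE _ _ _ hsa hr hc.1.1.2).1 (by linarith)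
  · simp [List.getLast?_cons, hlb']
  · exact (hE _ _ _ hsb hr hc.1.1.2).2 (by linarith)

end IsSuslinTree

/-- A directed path whose last vertex sends an arc to the first one is a directed cycle. -/
theorem IsPathIn.exists_relDicycle {S : Type*} {E : S → S → Prop} {T : Set S} {n : ℕ} (hn : 1 < n)
    {l : List S} {a b : S} (hl : IsPathIn E T n l) (ha : l.head? = some a)
    (hb : l.getLast? = some b) (hba : E b a) : ∃ c, Digraph'.RelDicycle E T n c := by
  have : NeZero n := ⟨by omega⟩
  have hlt : ∀ i : ZMod n, i.val < l.length := fun i => hl.length_eq ▸ i.val_lt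
  refine ⟨fun i => l[i.val]'(hlt i), hn.le, fun i j hij => ?_, fun i => hl.mem _ (List.getElem_mem _),
    fun i => ?_⟩
  · exact ZMod.val_injective n ((hl.nodup.getElem_inj_iff).1 hij)
  · have hone : (1 : ZMod n).val = 1 := by
      have : Fact (1 < n) := ⟨hn⟩
      exact ZMod.val_one n
    by_cases h : i.val + 1 < n
    · have hv : (i + 1).val = i.val + 1 := by
        rw [ZMod.val_add_of_lt (by rw [hone]; exact h), hone]
      simp only [hv]
      exact List.isChain_iff_getElem.1 hl.isChain _ _
    · have hi : i.val + 1 = n := by have := i.val_lt; omega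
      have hv : (i + 1).val = 0 := by
        rw [ZMod.val_add, hone, hi, Nat.mod_self]
      have h0 : 0 < l.length := by rw [hl.length_eq]; omega
      have ha' : l[0] = a := by
        rw [List.head?_eq_getElem?, List.getElem?_eq_getElem h0] at ha
        exact Option.some.inj ha
      have hb' : l[i.val]'(hlt i) = b := by
        have hi' : l.length - 1 = i.val := by rw [hl.length_eq]; omega
        rw [List.getLast?_eq_getElem?, hi', List.getElem?_eq_getElem (hlt i)] at hb
        exact Option.some.inj hb
      simp only [hv, ha', hb', hba]

/-- The comparability graph of a Suslin tree admits an orientation in which every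
uncountable set of vertices contains directed cycles of all lengths `n ≥ 3`. -/
theorem statement_11 {S : Type*} [PartialOrder S]
    -- `S` is a Suslin tree:
    (huncount : ¬ Countable S)
    (hpredlin : ∀ t : S, IsChain (· ≤ ·) (Set.Iio t))
    (hpredwf : ∀ t : S, (Set.Iio t).IsWF)
    (hchain : ∀ C : Set S, IsChain (· ≤ ·) C → C.Countable)
    (hantichain : ∀ A : Set S, IsAntichain (· ≤ ·) A → A.Countable) :
    ∃ D : Digraph' S,
      -- `D` is an orientation of the comparability graph of `S`:
      D.verts = Set.univ ∧
      (∀ u v : S, D.Arc u v → (u < v ∨ v < u)) ∧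
      (∀ u v : S, u < v → (D.Arc u v ∨ D.Arc v u)) ∧
      -- every uncountable set contains directed cycles of all lengths `n ≥ 3`:
      (∀ T : Set S, ¬ T.Countable → ∀ n : ℕ, 3 ≤ n → ∃ c, D.DicycleIn T n c) := by
  have hS : IsSuslinTree S := ⟨hpredlin, hpredwf, hchain, hantichain⟩
  obtain ⟨x, hx⟩ := hS.exists_real_label
  have hidx : ∀ c : S, ∃ f : S → ℕ, Set.InjOn f (Set.Iio c) := fun c =>
    Set.countable_iff_exists_injOn.1 (hS.countable_Iio c)
  choose e he using hidx
  have hsplit : ∀ r : S, ∃ z w : S, ¬ (Set.Ici r).Countable → r < z ∧ r < w ∧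
      ¬ (Set.Ici z).Countable ∧ ¬ (Set.Ici w).Countable ∧ ∀ c, z ≤ c → ¬ w ≤ c := by
    intro r
    by_cases hr : (Set.Ici r).Countable
    · exact ⟨r, r, fun h => absurd hr h⟩
    · obtain ⟨z, w, h⟩ := hS.exists_split hr
      exact ⟨z, w, fun _ => h⟩
  choose z w hzw using hsplit
  let L : S → S → Prop := fun a c => ∃ r, IsSelected e x a c r ∧ w r ≤ c
  let E : S → S → Prop := fun u v =>
    (u < v ∧ (L u v ↔ x u < x v)) ∨ (v < u ∧ ¬ (L v u ↔ x v < x u))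
  have hEcomp : ∀ u v, E u v → u < v ∨ v < u := by
    rintro u v (h | h)
    exacts [Or.inl h.1, Or.inr h.1]
  have hEtot : ∀ u v, u < v → E u v ∨ E v u := by
    intro u v huv
    by_cases h : L u v ↔ x u < x v
    · exact Or.inl (Or.inl ⟨huv, h⟩)
    · exact Or.inr (Or.inr ⟨huv, h⟩)
  have hEasymm : ∀ u v, E u v → ¬ E v u := by
    rintro u v (h | h) (h' | h')
    · exact lt_asymm h.1 h'.1
    · exact h'.2 h.2
    · exact h.2 h'.2
    · exact lt_asymm h.1 h'.1
  refine ⟨⟨Set.univ, E, fun _ _ _ => trivial, fun _ _ _ => trivial,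
    fun v h => hEasymm v v h h, hEasymm⟩, rfl, hEcomp, hEtot, fun T hT n hn => ?_⟩
  change ∃ c, Digraph'.RelDicycle E T n c
  obtain ⟨m, rfl⟩ : ∃ m, n = m + 1 := ⟨n - 1, by omega⟩
  by_contra hno
  have hnocyc : ∀ T' ⊆ T, ¬ ∃ l a b, IsPathIn E T' (m + 1) l ∧ l.head? = some a ∧
      l.getLast? = some b ∧ E b a := by
    rintro T' hT' ⟨l, a, b, hl, ha, hb, hba⟩
    exact hno (IsPathIn.exists_relDicycle (by omega)
      ⟨hl.length_eq, hl.nodup, hl.isChain, fun u hu => hT' (hl.mem u hu)⟩ ha hb hba)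
  obtain ⟨T₁, hT₁, hT₁c, hinc⟩ : ∃ T₁ ⊆ T, ¬ T₁.Countable ∧
      ¬ ∃ l a b v, IsPathIn E T₁ m l ∧ l.head? = some a ∧
        l.getLast? = some b ∧ (∀ u ∈ l, u ≤ v) ∧ x a < x b := by
    by_contra! hc
    refine hnocyc T subset_rfl (hS.exists_cycle_of_paths hx he (z := z)
      (fun r hr => ⟨(hzw r hr).1, (hzw r hr).2.2.1⟩) ?_ hT fun T' h h' => ?_)
    · intro a c r hsel hr hzc
      have hac := hsel.1.trans hsel.2.1
      have hL : ¬ L a c := by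
        rintro ⟨r', hsel', hw⟩
        obtain rfl := hS.isSelected_unique hsel hsel'
        exact (hzw r hr).2.2.2.2 c hzc hw
      exact ⟨fun h => Or.inr ⟨hac, by simp [hL, h]⟩,
        fun h => Or.inl ⟨hac, by simp [hL, h.le]⟩⟩
    · exact hc T' h h'
  obtain ⟨T₂, hT₂, hT₂c, hdec⟩ : ∃ T₂ ⊆ T₁, ¬ T₂.Countable ∧
      ¬ ∃ l a b v, IsPathIn E T₂ m l ∧ l.head? = some a ∧
        l.getLast? = some b ∧ (∀ u ∈ l, u ≤ v) ∧ - x a < - x b := by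
    by_contra! hc
    refine hnocyc T₁ hT₁ (hS.exists_cycle_of_paths (y := fun s => - x s)
      (fun a c hac h => hx a c hac (neg_injective h)) he (z := w)
      (fun r hr => ⟨(hzw r hr).2.1, (hzw r hr).2.2.2.1⟩) ?_ hT₁c fun T' h h' => ?_)
    · intro a c r hsel hr hwc
      have hac := hsel.1.trans hsel.2.1
      have habs : ∀ s t : S, |-x s - -x t| = |x s - x t| := fun s t => by
        rw [neg_sub_neg, abs_sub_comm]
      have hL : L a c := ⟨r, by simpa only [IsSelected, habs] using hsel, hwc⟩
      exact ⟨fun h => Or.inr ⟨hac, by simpa [hL] using h.le⟩,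
        fun h => Or.inl ⟨hac, by simpa [hL] using h⟩⟩
    · exact hc T' h h'
  obtain ⟨l, hlen, hlt, hlT, v, hv⟩ := hS.exists_chain_length m hT₂c
  obtain ⟨l', hperm, hl'⟩ := List.exists_perm_isChain (R := E) l
    (hlt.imp fun h => hEtot _ _ h)
  have hlen' : l'.length = m := hperm.length_eq.trans hlen
  have hnd : l'.Nodup := hperm.nodup_iff.2 (hlt.imp fun h => h.ne)
  have hmem : ∀ u ∈ l', u ∈ T₂ := fun u hu => hlT u (hperm.subset hu)
  have hbd : ∀ u ∈ l', u ≤ v := fun u hu => hv u (hperm.subset hu)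
  have h0 : 0 < l'.length := by omega
  have hlast : l'.length - 1 < l'.length := by omega
  have ha : l'.head? = some l'[0] := by
    rw [List.head?_eq_getElem?, List.getElem?_eq_getElem h0]
  have hb : l'.getLast? = some l'[l'.length - 1] := by
    rw [List.getLast?_eq_getElem?, List.getElem?_eq_getElem hlast]
  have hne : l'[0] ≠ l'[l'.length - 1] := fun h => by
    have := hnd.getElem_inj_iff.1 h
    omega
  have hxne : x l'[0] ≠ x l'[l'.length - 1] := by
    rcases hS.le_total_of_le (hbd _ (List.getElem_mem h0)) (hbd _ (List.getElem_mem hlast))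
      with h | h
    · exact hx _ _ (lt_of_le_of_ne h hne)
    · exact (hx _ _ (lt_of_le_of_ne h hne.symm)).symm
  rcases lt_or_gt_of_ne hxne with h | h
  · exact hinc ⟨l', _, _, v, ⟨hlen', hnd, hl', fun u hu => hT₂ (hmem u hu)⟩, ha, hb, hbd, h⟩
  · exact hdec ⟨l', _, _, v, ⟨hlen', hnd, hl', hmem⟩, ha, hb, hbd, neg_lt_neg h⟩
end

section
/- Let k be a positive integer and let D be a digraph such that every finite induced subdigraph of D has dichromatic number at most k. Then the dichromatic number of D is at most k. -/
/-- The dichromatic number of `D` is at most `k` (a natural number): the vertices can be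
colored with `k` colors so that every color class is acyclic. -/
def DichromaticLENat {V : Type*} (D : Digraph' V) (k : ℕ) : Prop :=
  ∃ f : V → Fin k, ∀ i : Fin k, D.AcyclicSet {v : V | f v = i}

/-- Compactness (Erdős–de Bruijn for digraphs): if every finite induced subdigraph of `D`
has dichromatic number at most `k > 0`, then so does `D`. -/
theorem statement_16 {V : Type*} (k : ℕ) (hk : 0 < k) (D : Digraph' V)
    (h : ∀ A : Set V, A.Finite → DichromaticLENat (D.induce A) k) :
    DichromaticLENat D k := by
  choose g hg using fun s : Finset V => h (s : Set V) s.finite_toSet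
  obtain ⟨χ, hχ⟩ := Finset.rado_selection g
  refine ⟨χ, fun i m c ⟨hm, hinj, hmem, harc⟩ => ?_⟩
  have : NeZero m := ⟨by omega⟩
  classical
  obtain ⟨t, hst, ht⟩ := hχ (Finset.univ.image c)
  have hc : ∀ j, c j ∈ Finset.univ.image c := fun j =>
    Finset.mem_image_of_mem c (Finset.mem_univ j)
  exact hg t i m c ⟨hm, hinj, fun j => (ht (c j) (hc j)).symm.trans (hmem j),
    fun j => ⟨harc j, hst (hc j), hst (hc (j + 1))⟩⟩
end

section
/- Let G be an undirected graph whose vertex set is a set of ordinals, and suppose D is an orientation of G such that for every W ⊆ V(G) with χ(G[W]) > ℵ₀ the induced subdigraph D[W] contains a directed cycle. Then there is a coloring c : E(G) → 2 of the edges of G with two colors such that for every W ⊆ V(G) with χ(G[W]) > ℵ₀, both colors appear on edges of the induced subgraph G[W]. -/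
/-- The chromatic number of `G` restricted to `A` is uncountable: `A` cannot be covered
by countably many `G`-independent sets. -/
def SimpleGraph.UncountablyChromaticOn {α : Type*} (G : SimpleGraph α) (A : Set α) : Prop :=
  ¬ ∃ F : ℕ → Set α, (∀ n, ∀ u ∈ F n, ∀ v ∈ F n, ¬ G.Adj u v) ∧ A ⊆ ⋃ n, F n

/-- A directed cycle over a linear order has both an increasing and a decreasing arc. -/
theorem Digraph'.DicycleIn.exists_lt_and_gt {α : Type*} [LinearOrder α] {D : Digraph' α}
    {W : Set α} {m : ℕ} {c : ZMod m → α} (h : D.DicycleIn W m c) :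
    (∃ u ∈ W, ∃ v ∈ W, D.Arc u v ∧ u < v) ∧ (∃ u ∈ W, ∃ v ∈ W, D.Arc u v ∧ v < u) := by
  obtain ⟨hm, -, hW, harc⟩ := h
  have : NeZero m := ⟨by omega⟩
  have hne (i : ZMod m) : c i ≠ c (i + 1) := fun h ↦ D.irrefl' (c i) (by
    simpa [← h] using harc i)
  obtain ⟨i, hi⟩ := Finite.exists_min c
  obtain ⟨j, hj⟩ := Finite.exists_max c
  exact ⟨⟨c i, hW i, _, hW _, harc i, (hi _).lt_of_ne (hne i)⟩,
    ⟨c j, hW j, _, hW _, harc j, (hj _).lt_of_ne (hne j).symm⟩⟩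

/-- If a graph `G` on a well-ordered vertex set (a set of ordinals) has an orientation
`D` such that `D[W]` contains a directed cycle whenever `χ(G[W]) > ℵ₀`, then the edges of
`G` can be 2-colored so that both colors appear on every induced subgraph of uncountable
chromatic number. -/
theorem statement_17 {α : Type*} [LinearOrder α] [WellFoundedLT α]
    (G : SimpleGraph α) (D : Digraph' α)
    -- `D` is an orientation of `G`:
    (hverts : D.verts = Set.univ)
    (hDG : ∀ u v : α, D.Arc u v → G.Adj u v)
    (hGD : ∀ u v : α, G.Adj u v → (D.Arc u v ∨ D.Arc v u))
    -- every induced subgraph of uncountable chromatic number contains a directed cycle: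
    (hcyc : ∀ W : Set α, G.UncountablyChromaticOn W → ∃ m c, D.DicycleIn W m c) :
    ∃ cc : Sym2 α → Bool, ∀ W : Set α, G.UncountablyChromaticOn W →
      (∃ u ∈ W, ∃ v ∈ W, G.Adj u v ∧ cc s(u, v) = false) ∧
      (∃ u ∈ W, ∃ v ∈ W, G.Adj u v ∧ cc s(u, v) = true) := by
  classical
  refine ⟨fun e ↦ decide (∃ u v, e = s(u, v) ∧ u < v ∧ D.Arc u v), fun W hW ↦ ?_⟩
  obtain ⟨m, c, hc⟩ := hcyc W hW
  obtain ⟨⟨u, hu, v, hv, huv, hlt⟩, ⟨x, hx, y, hy, hxy, hgt⟩⟩ := hc.exists_lt_and_gt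
  refine ⟨⟨x, hx, y, hy, hDG x y hxy, decide_eq_false ?_⟩,
    ⟨u, hu, v, hv, hDG u v huv, decide_eq_true ⟨u, v, rfl, hlt, huv⟩⟩⟩
  rintro ⟨a, b, hab, hab_lt, harc⟩
  rcases Sym2.eq_iff.mp hab with ⟨rfl, rfl⟩ | ⟨rfl, rfl⟩
  · exact hgt.asymm hab_lt
  · exact D.asymm' _ _ hxy harc
end

section
/- Let G be an undirected graph whose vertex set is a set of ordinals, and suppose G has an orientation D with uncountable dichromatic number. Then there is a coloring c : E(G) → 2 of the edges of G with two colors such that whenever V(G) is partitioned into countably many pieces {V_i : i < ω}, there is some i < ω such that both colors appear on edges of the induced subgraph G[V_i]. -/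
/-- If a graph `G` on a well-ordered vertex set (a set of ordinals) has an orientation
`D` with uncountable dichromatic number, then the edges of `G` can be 2-colored so that
for every partition of the vertices into countably many pieces, both colors appear on
the subgraph induced on one of the pieces. -/
theorem statement_18 {α : Type*} [LinearOrder α] [WellFoundedLT α]
    (G : SimpleGraph α) (D : Digraph' α)
    -- `D` is an orientation of `G`:
    (hverts : D.verts = Set.univ)
    (hDG : ∀ u v : α, D.Arc u v → G.Adj u v)
    (hGD : ∀ u v : α, G.Adj u v → (D.Arc u v ∨ D.Arc v u))
    -- `D` has uncountable dichromatic number: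
    (hunc : D.UncountableDichromatic) :
    ∃ cc : Sym2 α → Bool, ∀ F : ℕ → Set α,
      (Pairwise fun i j => Disjoint (F i) (F j)) → (⋃ n, F n) = Set.univ →
      ∃ n : ℕ,
        (∃ u ∈ F n, ∃ v ∈ F n, G.Adj u v ∧ cc s(u, v) = false) ∧
        (∃ u ∈ F n, ∃ v ∈ F n, G.Adj u v ∧ cc s(u, v) = true) := by
  classical
  refine ⟨fun e => decide (∃ u v, u < v ∧ D.Arc u v ∧ e = s(u, v)), fun F _ hF => ?_⟩
  have hcyc : ∃ n, ¬ D.AcyclicSet (F n) := by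
    by_contra! h
    exact hunc ⟨F, h, by rw [hF]; exact Set.subset_univ _⟩
  obtain ⟨n, hn⟩ := hcyc
  simp only [Digraph'.AcyclicSet, not_forall, not_not] at hn
  obtain ⟨m, c, hm, -, hcF, hcArc⟩ := hn
  have : NeZero m := ⟨by omega⟩
  obtain ⟨i, hi⟩ := Finite.exists_max c
  have hout : D.Arc (c i) (c (i + 1)) := hcArc i
  have hin : D.Arc (c (i - 1)) (c i) := by simpa using hcArc (i - 1)
  have hin_lt : c (i - 1) < c i :=
    (hi _).lt_of_ne fun h => D.irrefl' (c i) (by rwa [h] at hin)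
  refine ⟨n, ⟨c i, hcF _, c (i + 1), hcF _, hDG _ _ hout, ?_⟩,
    ⟨c (i - 1), hcF _, c i, hcF _, hDG _ _ hin, ?_⟩⟩
  · rw [decide_eq_false_iff_not]
    rintro ⟨u, v, huv, harc, he⟩
    rcases Sym2.eq_iff.1 he with ⟨rfl, rfl⟩ | ⟨rfl, rfl⟩
    · exact huv.not_ge (hi _)
    · exact D.asymm' _ _ hout harc
  · exact decide_eq_true ⟨_, _, hin_lt, hin, rfl⟩
end

section
/- Assume ◇⁺ holds: there exist families 𝒮_β = {S_{β,n} : n < ω} of subsets of β for each β < ω₁ such that for every X ⊆ ω₁ there is a club (closed unbounded) set C ⊆ ω₁ with X ∩ β ∈ 𝒮_β for every β ∈ C. Let G be an undirected graph on vertex set ω₁ with χ(G) = ℵ₁. Then there is an orientation D* of G such that for every A ⊆ ω₁ with χ(G[A]) = ℵ₁ and every orientation D of the half graph H_{ω,ω}, D embeds into the induced subdigraph D*[A]. -/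
/-- The adjacency relation of the half graph `H_{ω,ω}` on `ω × 2`:
`(k,0)` and `(ℓ,1)` are adjacent whenever `k ≤ ℓ`. -/
def HalfAdj (u v : ℕ × Fin 2) : Prop :=
  (u.2 = 0 ∧ v.2 = 1 ∧ u.1 ≤ v.1) ∨ (u.2 = 1 ∧ v.2 = 0 ∧ v.1 ≤ u.1)

section OmegaOne

open Set

/-- Unbounded subsets of a linear order that are closed under suprema of nonempty subsets. -/
structure IsClubIn {W : Type*} [LinearOrder W] (C : Set W) : Prop where
  unbounded : ∀ a, ∃ b ∈ C, a ≤ b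
  closed : ∀ B ⊆ C, B.Nonempty → ∀ b, IsLUB B b → b ∈ C

/-- Linear orders of type `ω₁`: uncountable well-orders with countable initial segments. -/
class IsOmegaOneLike (W : Type*) [LinearOrder W] : Prop where
  wf : WellFoundedLT W
  countable_Iic : ∀ a : W, (Iic a).Countable
  uncountable : Uncountable W

attribute [instance] IsOmegaOneLike.wf IsOmegaOneLike.uncountable

/-- A proper colouring of `A` with countably many colours shows that `A` is countably chromatic. -/
theorem SimpleGraph.not_uncountablyChromaticOn_of_coloring {α κ : Type*} [Countable κ]
    {G : SimpleGraph α} {A : Set α} (c : α → κ)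
    (hc : ∀ u ∈ A, ∀ v ∈ A, G.Adj u v → c u ≠ c v) : ¬ G.UncountablyChromaticOn A := by
  obtain ⟨e, he⟩ := Countable.exists_injective_nat κ
  refine not_not.2 ⟨fun n => {u ∈ A | e (c u) = n}, ?_, ?_⟩
  · rintro n u ⟨hu, rfl⟩ v ⟨hv, hvn⟩ huv
    exact hc u hu v hv huv (he hvn.symm)
  · intro u hu
    exact mem_iUnion.2 ⟨_, hu, rfl⟩

/-- Given countably many families of pairs `(t, p)` of finite sets, some predicate follows on `t`
the pattern `p` for a member `(t, p)` of each family whose first components cannot be met by a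
single finite set. -/
theorem exists_pred_realizing {W ι : Type*} [Countable ι] (Φ : ι → Set (Finset W × Finset W)) :
    ∃ o : W → Prop, ∀ i, (∀ F : Finset W, ∃ q ∈ Φ i, Disjoint q.1 F) →
      ∃ q ∈ Φ i, ∀ x ∈ q.1, (o x ↔ x ∈ q.2) := by
  classical
  obtain ⟨e, he⟩ := Countable.exists_injective_nat ι
  have hstep : ∀ (n : ℕ) (F : Finset W), ∃ q : Finset W × Finset W, Disjoint q.1 F ∧
      ∀ i, e i = n → (∃ q ∈ Φ i, Disjoint q.1 F) → q ∈ Φ i := by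
    intro n F
    by_cases h : ∃ i, e i = n ∧ ∃ q ∈ Φ i, Disjoint q.1 F
    · obtain ⟨i, hi, q, hq, hF⟩ := h
      refine ⟨q, hF, fun j hj _ => ?_⟩
      rwa [he (hj.trans hi.symm)]
    · exact ⟨(∅, ∅), by simp, fun i hi hq => (h ⟨i, hi, hq⟩).elim⟩
  choose step hdisj hmem using hstep
  let F : ℕ → Finset W := fun n => Nat.rec ∅ (fun k E => E ∪ (step k E).1) n
  have hF : ∀ n, F (n + 1) = F n ∪ (step n (F n)).1 := fun n => rfl
  have hmono : Monotone F := monotone_nat_of_le_succ fun n => by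
    rw [hF]; exact Finset.subset_union_left
  have huniq : ∀ m n x, m < n → x ∈ (step m (F m)).1 → x ∉ (step n (F n)).1 := by
    intro m n x hmn hxm hxn
    refine Finset.disjoint_left.1 (hdisj n (F n)) hxn (hmono (Nat.succ_le_of_lt hmn) ?_)
    rw [hF]
    exact Finset.mem_union_right _ hxm
  refine ⟨fun x => ∃ n, x ∈ (step n (F n)).1 ∧ x ∈ (step n (F n)).2, fun i hi => ?_⟩
  refine ⟨step (e i) (F (e i)), hmem _ _ i rfl (hi _), fun x hx => ⟨?_, fun h => ⟨_, hx, h⟩⟩⟩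
  rintro ⟨n, hn, hn'⟩
  rcases lt_trichotomy n (e i) with h | h | h
  · exact (huniq _ _ x h hn hx).elim
  · rwa [← h]
  · exact (huniq _ _ x h hx hn).elim

variable {W : Type*} [LinearOrder W] [IsOmegaOneLike W]

theorem Set.Countable.exists_forall_lt {s : Set W} (hs : s.Countable) : ∃ b, ∀ x ∈ s, x < b := by
  by_contra! h
  refine not_countable (α := W) (countable_univ_iff.1 ?_)
  refine (hs.biUnion fun a _ => IsOmegaOneLike.countable_Iic a).mono fun b _ => ?_
  obtain ⟨x, hx, hbx⟩ := h b
  exact mem_biUnion hx hbx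

theorem exists_isLUB_of_countable {s : Set W} (hs : s.Countable) : ∃ b, IsLUB s b := by
  obtain ⟨b, hb⟩ := hs.exists_forall_lt
  have hne : (upperBounds s).Nonempty := ⟨b, fun x hx => (hb x hx).le⟩
  obtain ⟨m, hm, hmin⟩ := WellFounded.has_min (wellFounded_lt (α := W)) _ hne
  exact ⟨m, hm, fun c hc => not_lt.1 (hmin c hc)⟩

/-- The elements of a club that are closed under a function on pairs of finite sets
form a club. -/
theorem IsClubIn.closedUnder {C : Set W} (hC : IsClubIn C) (h : Finset W × Finset W → W) :
    IsClubIn {c ∈ C | ∀ q : Finset W × Finset W,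
      (∀ x ∈ q.1, x < c) → (∀ x ∈ q.2, x < c) → h q < c} := by
  constructor
  · intro a
    have hnext : ∀ b : W, ∃ c ∈ C, b < c ∧ ∀ q : Finset W × Finset W,
        (∀ x ∈ q.1, x < b) → (∀ x ∈ q.2, x < b) → h q < c := by
      intro b
      have hcount : (Iio b).Countable := (IsOmegaOneLike.countable_Iic b).mono Iio_subset_Iic_self
      have hfin : {t : Finset W | ∀ x ∈ t, x < b}.Countable :=
        (((Set.countable_ofPred_finite_subset hcount).preimage Finset.coe_injective).mono
          fun t ht => And.intro t.finite_toSet fun x hx => ht x hx)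
      obtain ⟨d, hd⟩ := (((hfin.prod hfin).image h).union (countable_singleton b)).exists_forall_lt
      obtain ⟨c, hcC, hdc⟩ := hC.unbounded d
      exact ⟨c, hcC, (hd b (Or.inr rfl)).trans_le hdc,
        fun q h1 h2 => (hd _ (Or.inl ⟨q, ⟨h1, h2⟩, rfl⟩)).trans_le hdc⟩
    choose next hnC hlt hq using hnext
    let s : ℕ → W := fun n => next^[n + 1] a
    have hs : ∀ n, s (n + 1) = next (s n) := fun n => Function.iterate_succ_apply' _ _ _
    have hmono : StrictMono s := strictMono_nat_of_lt_succ fun n => by rw [hs]; exact hlt _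
    obtain ⟨b, hb⟩ := exists_isLUB_of_countable (countable_range s)
    have hsb : ∀ n, s n < b := fun n => (hmono n.lt_succ_self).trans_le (hb.1 ⟨_, rfl⟩)
    have hfin : ∀ t : Finset W, (∀ x ∈ t, x < b) → ∃ n, ∀ x ∈ t, x < s n := by
      classical
      intro t
      induction t using Finset.induction_on with
      | empty => exact fun _ => ⟨0, by simp⟩
      | insert x t _ ih =>
        intro ht
        obtain ⟨n, hn⟩ := ih fun y hy => ht y (Finset.mem_insert_of_mem hy)
        obtain ⟨_, ⟨m, rfl⟩, hm⟩ := (lt_isLUB_iff hb).1 (ht x (Finset.mem_insert_self _ _))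
        refine ⟨max m n, fun y hy => ?_⟩
        rcases Finset.mem_insert.1 hy with rfl | hy
        · exact hm.trans_le (hmono.monotone (le_max_left _ _))
        · exact (hn y hy).trans_le (hmono.monotone (le_max_right _ _))
    refine ⟨b, ⟨hC.closed (range s) ?_ (range_nonempty s) b hb, fun q h1 h2 => ?_⟩,
      (hlt a).le.trans (hb.1 ⟨0, rfl⟩)⟩
    · rintro _ ⟨n, rfl⟩
      have : s n = next (next^[n] a) := Function.iterate_succ_apply' _ _ _
      rw [this]
      exact hnC _
    · obtain ⟨m, hm⟩ := hfin _ h1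
      obtain ⟨n, hn⟩ := hfin _ h2
      refine lt_of_lt_of_le ?_ (hsb (max m n + 1)).le
      rw [hs]
      exact hq _ q (fun x hx => (hm x hx).trans_le (hmono.monotone (le_max_left _ _)))
        fun x hx => (hn x hx).trans_le (hmono.monotone (le_max_right _ _))
  · intro B hB hne b hb
    refine ⟨hC.closed B (fun x hx => (hB hx).1) hne b hb, fun q h1 h2 => ?_⟩
    have hfin : ∀ t : Finset W, (∀ x ∈ t, x < b) → ∃ c ∈ B, ∀ x ∈ t, x < c := by
      classical
      intro t
      induction t using Finset.induction_on with
      | empty => exact fun _ => ⟨hne.some, hne.some_mem, by simp⟩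
      | insert x t _ ih =>
        intro ht
        obtain ⟨c, hc, hct⟩ := ih fun y hy => ht y (Finset.mem_insert_of_mem hy)
        obtain ⟨d, hd, hxd⟩ := (lt_isLUB_iff hb).1 (ht x (Finset.mem_insert_self _ _))
        rcases le_total c d with hcd | hcd
        · refine ⟨d, hd, fun y hy => ?_⟩
          rcases Finset.mem_insert.1 hy with rfl | hy
          exacts [hxd, (hct y hy).trans_le hcd]
        · refine ⟨c, hc, fun y hy => ?_⟩
          rcases Finset.mem_insert.1 hy with rfl | hy
          exacts [hxd.trans_le hcd, hct y hy]
    classical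
    obtain ⟨c, hc, hcq⟩ := hfin (q.1 ∪ q.2) fun x hx =>
      (Finset.mem_union.1 hx).elim (h1 x) (h2 x)
    exact ((hB hc).2 q (fun x hx => hcq x (Finset.mem_union_left _ hx))
      fun x hx => hcq x (Finset.mem_union_right _ hx)).trans_le (hb.1 hc)

/-- In a set of uncountable chromatic number some vertex has infinitely many neighbours
below an element of a given club that does not exceed it. -/
theorem SimpleGraph.UncountablyChromaticOn.exists_infinite_neighbors {G : SimpleGraph W}
    {A : Set W} (hA : G.UncountablyChromaticOn A) {C : Set W} (hC : IsClubIn C) :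
    ∃ y ∈ A, ∃ c ∈ C, c ≤ y ∧ {x ∈ A | x < c ∧ G.Adj x y}.Infinite := by
  classical
  by_contra! hfin
  have hnext : ∀ y : W, ∃ c ∈ C, y < c ∧ ∀ d ∈ C, y < d → c ≤ d := by
    intro y
    have hne : {c ∈ C | y < c}.Nonempty := by
      obtain ⟨a, ha⟩ := (countable_singleton y).exists_forall_lt
      obtain ⟨c, hc, hac⟩ := hC.unbounded a
      exact ⟨c, hc, (ha y rfl).trans_le hac⟩
    obtain ⟨c, ⟨hc, hyc⟩, hmin⟩ := WellFounded.has_min (wellFounded_lt (α := W)) _ hne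
    exact ⟨c, hc, hyc, fun d hd hyd => not_lt.1 (hmin d ⟨hd, hyd⟩)⟩
  choose f hfC hlt hmin using hnext
  have hcross : ∀ y ∈ A, {x ∈ A | f x ≤ y ∧ G.Adj x y}.Finite := by
    intro y hy
    rcases {x ∈ A | f x ≤ y ∧ G.Adj x y}.eq_empty_or_nonempty with h | hne
    · rw [h]; exact finite_empty
    let B : Set W := f '' {x ∈ A | f x ≤ y ∧ G.Adj x y}
    have hBy : y ∈ upperBounds B := by
      rintro _ ⟨x, hx, rfl⟩
      exact hx.2.1
    obtain ⟨b, hb⟩ := exists_isLUB_of_countable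
      ((IsOmegaOneLike.countable_Iic y).mono hBy : B.Countable)
    refine (hfin y hy b (hC.closed B ?_ (hne.image f) b hb) (hb.2 hBy)).subset fun x hx =>
      ⟨hx.1, (hlt x).trans_le (hb.1 ⟨x, hx, rfl⟩), hx.2.2⟩
    rintro _ ⟨x, _, rfl⟩
    exact hfC x
  have hcol : ∃ c : W → ℕ, ∀ y ∈ A, ∀ x ∈ A, f x ≤ y → G.Adj x y → c x ≠ c y := by
    have hfresh : ∀ (y : W) (c : ∀ x, x < y → ℕ), ∃ n : ℕ, ∀ (_ : y ∈ A), ∀ x ∈ A,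
        f x ≤ y → G.Adj x y → ∀ hxy : x < y, c x hxy ≠ n := by
      intro y c
      by_cases hy : y ∈ A
      · obtain ⟨n, hn⟩ := ((hcross y hy).image
          fun x => if hxy : x < y then c x hxy else 0).exists_notMem
        refine ⟨n, fun _ x hx hxy hadj hxy' heq => hn ⟨x, ⟨hx, hxy, hadj⟩, ?_⟩⟩
        simp [hxy', heq]
      · exact ⟨0, fun h => (hy h).elim⟩
    choose next hn using hfresh
    refine ⟨(wellFounded_lt (α := W)).fix next, fun y hy x hx hxy hadj => ?_⟩
    rw [WellFounded.fix_eq _ _ y]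
    exact hn y (fun x _ => (wellFounded_lt (α := W)).fix next x) hy x hx hxy hadj
      ((hlt x).trans_le hxy)
  obtain ⟨c, hc⟩ := hcol
  have hblock : ∀ a : W, ∃ g : W → ℕ, InjOn g (Iic a) := fun a =>
    (countable_iff_exists_injOn.1 (IsOmegaOneLike.countable_Iic a))
  choose g hg using hblock
  refine SimpleGraph.not_uncountablyChromaticOn_of_coloring (G := G) (A := A)
    (fun y => (c y, g (f y) y)) ?_ hA
  have key : ∀ u ∈ A, ∀ v ∈ A, u < v → G.Adj u v → (c u, g (f u) u) ≠ (c v, g (f v) v) := by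
    intro u hu v hv huv hadj heq
    rw [Prod.mk.injEq] at heq
    rcases le_or_gt (f u) v with h | h
    · exact hc v hv u hu h hadj heq.1
    · have hf : f u = f v :=
        le_antisymm (hmin u _ (hfC v) (huv.trans (hlt v))) (hmin v _ (hfC u) h)
      rw [hf] at heq
      exact huv.ne (hg (f v) (huv.trans (hlt v)).le (hlt v).le heq.2)
  intro u hu v hv hadj
  rcases lt_trichotomy u v with h | rfl | h
  · exact key u hu v hv h hadj
  · exact (G.irrefl hadj).elim
  · exact (key v hv u hu h hadj.symm).symm

/-- The vertex `y` is above `t`, adjacent to all of `t`, and the predicate `o y` follows the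
pattern `p` on `t`, where `q = (t, p)`. -/
def RealizesPattern (G : SimpleGraph W) (o : W → W → Prop) (y : W) (q : Finset W × Finset W) :
    Prop :=
  ∀ x ∈ q.1, x < y ∧ G.Adj x y ∧ (o y x ↔ x ∈ q.2)

/-- Under `◇⁺` the edges of `G` can be labelled by two labels such that every set of uncountable
chromatic number contains a sequence for which all patterns on initial segments are realized
unboundedly often. -/
theorem exists_labelling_realizing_patterns (S : W → ℕ → Set W)
    (hS : ∀ X : Set W, ∃ C, IsClubIn C ∧ ∀ c ∈ C, ∃ n, X ∩ Iio c = S c n) (G : SimpleGraph W) :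
    ∃ o : W → W → Prop, ∀ A : Set W, G.UncountablyChromaticOn A →
      ∃ x : ℕ → W, Function.Injective x ∧ (∀ n, x n ∈ A) ∧
        ∀ q : Finset W × Finset W, (∃ k, (q.1 : Set W) = x '' Iio k) → q.2 ⊆ q.1 →
          ∀ b, ∃ y ∈ A, b < y ∧ RealizesPattern G o y q := by
  classical
  obtain ⟨e⟩ : Nonempty ((Finset W × Finset W) ↪ W) := by
    rw [← Cardinal.le_def]
    simp [Cardinal.mul_eq_self (Cardinal.aleph0_le_mk W)]
  have hsplit : ∀ y : W, ∃ o : W → Prop, ∀ i : Iic y × ℕ,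
      (∀ F : Finset W, ∃ q : Finset W × Finset W, ((∀ x ∈ q.1, x < i.1 ∧ G.Adj x y) ∧
        e q ∈ S i.1 i.2) ∧ Disjoint q.1 F) →
      ∃ q : Finset W × Finset W, ((∀ x ∈ q.1, x < i.1 ∧ G.Adj x y) ∧
        e q ∈ S i.1 i.2) ∧ ∀ x ∈ q.1, (o x ↔ x ∈ q.2) := by
    intro y
    have : Countable (Iic y) := (IsOmegaOneLike.countable_Iic y).to_subtype
    exact exists_pred_realizing fun i : Iic y × ℕ => {q : Finset W × Finset W |
      (∀ x ∈ q.1, x < i.1 ∧ G.Adj x y) ∧ e q ∈ S i.1 i.2}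
  choose o ho using hsplit
  refine ⟨o, fun A hA => ?_⟩
  by_contra! hbad
  let Φ : Set (Finset W × Finset W) := {q | q.2 ⊆ q.1 ∧
    ∃ b, ∀ y ∈ A, b < y → ¬ RealizesPattern G o y q}
  have hbound : ∀ q, ∃ b, q ∈ Φ → ∀ y ∈ A, b < y → ¬ RealizesPattern G o y q := by
    intro q
    by_cases hq : q ∈ Φ
    · exact hq.2.imp fun b hb _ => hb
    · exact ⟨e q, fun h => (hq h).elim⟩
  choose g hg using hbound
  obtain ⟨C, hC, hCS⟩ := hS (e '' Φ)
  obtain ⟨y, hyA, c, ⟨hcC, hcl⟩, hcy, hinf⟩ :=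
    hA.exists_infinite_neighbors (hC.closedUnder fun q => max (e q) (g q))
  obtain ⟨n, hn⟩ := hCS c hcC
  obtain ⟨q, ⟨hqN, hqS⟩, hqo⟩ := ho y (⟨c, hcy⟩, n) fun F => by
    have hinf' := hinf.sdiff F.finite_toSet
    let x := hinf'.natEmbedding
    have hx : ∀ n, (x n : W) ∈ {x ∈ A | x < c ∧ G.Adj x y} \ (F : Set W) := fun n => (x n).2
    obtain ⟨q, ⟨k, hk⟩, hqq, b, hb⟩ := hbad (fun n => x n)
      (Subtype.val_injective.comp x.injective) fun n => (hx n).1.1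
    have hq : ∀ z ∈ q.1, z ∈ {x ∈ A | x < c ∧ G.Adj x y} \ (F : Set W) := by
      intro z hz
      obtain ⟨i, _, rfl⟩ : z ∈ (fun n => (x n : W)) '' Iio k := hk ▸ hz
      exact hx i
    refine ⟨q, ⟨fun z hz => (hq z hz).1.2, ?_⟩, Finset.disjoint_left.2 fun z hz => (hq z hz).2⟩
    change e q ∈ S c n
    rw [← hn]
    exact ⟨⟨q, ⟨hqq, b, hb⟩, rfl⟩, (le_max_left _ _).trans_lt (hcl q (fun z hz => (hq z hz).1.2.1)
      fun z hz => (hq z (hqq hz)).1.2.1)⟩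
  change e q ∈ S c n at hqS
  rw [← hn] at hqS
  obtain ⟨⟨q', hq', heq⟩, hqc⟩ := hqS
  obtain rfl := e.injective heq
  refine hg q' hq' y hyA ?_ fun x hx => ⟨(hqN x hx).1.trans_le hcy, (hqN x hx).2, hqo x hx⟩
  exact ((le_max_right _ _).trans_lt (hcl q' (fun z hz => (hqN z hz).1)
    fun z hz => (hqN z (hq'.1 hz)).1)).trans_le hcy

/-- Every orientation of the half graph embeds into a suitable orientation of `G` restricted to
any set of uncountable chromatic number. -/
theorem exists_orientation_embedding_halfGraph (S : W → ℕ → Set W)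
    (hS : ∀ X : Set W, ∃ C, IsClubIn C ∧ ∀ c ∈ C, ∃ n, X ∩ Iio c = S c n) (G : SimpleGraph W) :
    ∃ Arc : W → W → Prop, (∀ u v, Arc u v → ¬ Arc v u) ∧ (∀ u v, Arc u v → G.Adj u v) ∧
      (∀ u v, G.Adj u v → Arc u v ∨ Arc v u) ∧
      ∀ A : Set W, G.UncountablyChromaticOn A → ∀ D : Digraph' (ℕ × Fin 2),
        (∀ u v, D.Arc u v → HalfAdj u v) →
        ∃ f : ℕ × Fin 2 → W, Function.Injective f ∧ (∀ u, f u ∈ A) ∧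
          ∀ u v, D.Arc u v → Arc (f u) (f v) := by
  classical
  obtain ⟨o, ho⟩ := exists_labelling_realizing_patterns S hS G
  refine ⟨fun u v => G.Adj u v ∧ ((u < v ∧ o v u) ∨ (v < u ∧ ¬ o u v)), ?_, fun u v h => h.1,
    ?_, fun A hA D hD => ?_⟩
  · rintro u v ⟨_, ⟨h1, h2⟩ | ⟨h1, h2⟩⟩ ⟨_, ⟨h3, h4⟩ | ⟨h3, h4⟩⟩
    exacts [h1.asymm h3, h4 h2, h2 h4, h1.asymm h3]
  · intro u v h
    rcases lt_or_gt_of_ne h.ne with huv | huv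
    · by_cases hv : o v u
      exacts [Or.inl ⟨h, Or.inl ⟨huv, hv⟩⟩, Or.inr ⟨h.symm, Or.inr ⟨huv, hv⟩⟩]
    · by_cases hu : o u v
      exacts [Or.inr ⟨h.symm, Or.inl ⟨huv, hu⟩⟩, Or.inl ⟨h, Or.inr ⟨huv, hu⟩⟩]
  obtain ⟨x, hxinj, hxA, hx⟩ := ho A hA
  have hnext : ∀ (l : ℕ) (b : W), ∃ y ∈ A, b < y ∧ ∀ k ≤ l,
      x k < y ∧ G.Adj (x k) y ∧ (o y (x k) ↔ D.Arc (k, 0) (l, 1)) := by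
    intro l b
    obtain ⟨y, hyA, hby, hy⟩ := hx ((Finset.range (l + 1)).image x,
      ((Finset.range (l + 1)).filter fun k => D.Arc (k, 0) (l, 1)).image x)
      ⟨l + 1, by ext; simp⟩ (Finset.image_subset_image (Finset.filter_subset _ _)) b
    refine ⟨y, hyA, hby, fun k hk => ?_⟩
    obtain ⟨h1, h2, h3⟩ := hy (x k)
      (Finset.mem_image_of_mem x (Finset.mem_range.2 (Nat.lt_succ_of_le hk)))
    refine ⟨h1, h2, h3.trans ?_⟩
    simp only [Finset.mem_image, Finset.mem_filter, Finset.mem_range]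
    constructor
    · rintro ⟨i, ⟨_, hi⟩, hik⟩
      rwa [← hxinj hik]
    · exact fun h => ⟨k, ⟨Nat.lt_succ_of_le hk, h⟩, rfl⟩
  choose next hnA hlt hn using hnext
  obtain ⟨b, hb⟩ := (countable_range x).exists_forall_lt
  let z : ℕ → W := fun l => Nat.rec b next l
  have hz : ∀ l, z (l + 1) = next l (z l) := fun l => rfl
  have hmono : StrictMono z := strictMono_nat_of_lt_succ fun l => hlt l (z l)
  have hxz : ∀ k l, x k < z l := fun k l => (hb _ ⟨k, rfl⟩).trans_le (hmono.monotone l.zero_le)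
  refine ⟨fun u => if u.2 = 0 then x u.1 else z (u.1 + 1), ?_, ?_, ?_⟩
  · rintro ⟨k, i⟩ ⟨l, j⟩ h
    fin_cases i <;> fin_cases j <;> simp at h
    · rw [hxinj h]
    · exact ((hxz k (l + 1)).ne h).elim
    · exact ((hxz l (k + 1)).ne h.symm).elim
    · have := hmono.injective (a₁ := k + 1) (a₂ := l + 1) h
      simpa using this
  · rintro ⟨k, i⟩
    fin_cases i
    · exact hxA k
    · exact hnA k _
  · rintro ⟨k, i⟩ ⟨l, j⟩ h
    rcases hD _ _ h with ⟨hi, hj, hkl⟩ | ⟨hi, hj, hkl⟩ <;> dsimp only at hi hj hkl <;> subst hi hj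
    · obtain ⟨h1, h2, h3⟩ := hn l (z l) k hkl
      exact ⟨h2, Or.inl ⟨h1, h3.2 h⟩⟩
    · obtain ⟨h1, h2, h3⟩ := hn k (z k) l hkl
      exact ⟨h2.symm, Or.inr ⟨h1, fun h' => D.asymm' _ _ h (h3.1 h')⟩⟩

end OmegaOne

instance isOmegaOneLike_Iio_ord_aleph_one.{u} :
    IsOmegaOneLike (Set.Iio (Cardinal.aleph.{u} 1).ord) where
  wf := inferInstance
  countable_Iic a := by
    have h : (Set.Iio (Order.succ (a : Ordinal.{u}))).Countable := by
      rw [← Cardinal.le_aleph0_iff_set_countable, Cardinal.mk_Iio_ordinal,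
        Cardinal.lift_le_aleph0, ← Order.lt_succ_iff, Cardinal.succ_aleph0, ← Cardinal.lt_ord]
      exact (Cardinal.isSuccLimit_ord (Cardinal.aleph0_le_aleph 1)).succ_lt a.2
    refine (h.preimage Subtype.val_injective).mono fun b hb => ?_
    exact Set.mem_Iio.2 (Order.lt_succ_of_le (show (b : Ordinal) ≤ a from hb))
  uncountable := by
    rw [← not_countable_iff, ← Cardinal.mk_le_aleph0_iff, Cardinal.mk_Iio_ordinal,
      Cardinal.lift_le_aleph0, Cardinal.card_ord, not_le]
    exact Cardinal.aleph0_lt_aleph_one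

/-- The ordinals below `ω₁` in any two universes are order isomorphic. -/
theorem nonempty_orderIso_Iio_ord_aleph_one.{u, v} :
    Nonempty (Set.Iio (Cardinal.aleph.{u} 1).ord ≃o Set.Iio (Cardinal.aleph.{v} 1).ord) := by
  obtain ⟨e⟩ := Ordinal.lift_type_eq.{u + 1, v + 1, 0}
    (r := fun a b : Set.Iio (Cardinal.aleph.{u} 1).ord => a < b)
    (s := fun a b : Set.Iio (Cardinal.aleph.{v} 1).ord => a < b) |>.1 (by
      simp)
  exact ⟨OrderIso.ofRelIsoLT e⟩

/-- Under `◇⁺`, every graph `G` on `ω₁` of chromatic number `ℵ₁` has an orientation `D*`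
such that every orientation of the half graph `H_{ω,ω}` embeds into `D*[A]` whenever
`χ(G[A]) = ℵ₁`.  (The vertex set `ω₁` is taken to be the set of ordinals below
`(ℵ₁).ord`.) -/
theorem statement_19
    -- `◇⁺` holds, witnessed by the families `𝒮_β = {S β n : n < ω}`:
    (S : Ordinal → ℕ → Set Ordinal)
    (hSsub : ∀ β < (Cardinal.aleph 1).ord, ∀ n : ℕ, S β n ⊆ Set.Iio β)
    (hguess : ∀ X ⊆ Set.Iio (Cardinal.aleph 1).ord, ∃ C : Set Ordinal,
      C ⊆ Set.Iio (Cardinal.aleph 1).ord ∧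
      -- `C` is unbounded in `ω₁`:
      (∀ γ < (Cardinal.aleph 1).ord, ∃ β ∈ C, γ ≤ β) ∧
      -- `C` is closed under suprema of bounded nonempty subsets:
      (∀ A ⊆ C, A.Nonempty → sSup A < (Cardinal.aleph 1).ord → sSup A ∈ C) ∧
      -- `C` guesses `X`:
      (∀ β ∈ C, ∃ n : ℕ, X ∩ Set.Iio β = S β n))
    -- `G` is a graph on vertex set `ω₁` of chromatic number `ℵ₁`:
    (G : SimpleGraph Ordinal)
    (hG : ∀ u v : Ordinal, G.Adj u v →
      u < (Cardinal.aleph 1).ord ∧ v < (Cardinal.aleph 1).ord)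
    (hchr : G.UncountablyChromaticOn (Set.Iio (Cardinal.aleph 1).ord)) :
    ∃ Dstar : Digraph' Ordinal,
      -- `D*` is an orientation of `G`:
      Dstar.verts = Set.Iio (Cardinal.aleph 1).ord ∧
      (∀ u v : Ordinal, Dstar.Arc u v → G.Adj u v) ∧
      (∀ u v : Ordinal, G.Adj u v → (Dstar.Arc u v ∨ Dstar.Arc v u)) ∧
      -- every orientation of `H_{ω,ω}` embeds into `D*[A]` whenever `χ(G[A]) = ℵ₁`:
      ∀ A ⊆ Set.Iio (Cardinal.aleph 1).ord, G.UncountablyChromaticOn A →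
        ∀ D : Digraph' (ℕ × Fin 2), D.verts = Set.univ →
          (∀ u v, D.Arc u v → HalfAdj u v) →
          (∀ u v, HalfAdj u v → (D.Arc u v ∨ D.Arc v u)) →
          D.Embeds (Dstar.induce A) := by
  obtain ⟨φ⟩ := nonempty_orderIso_Iio_ord_aleph_one
  let T : Set.Iio (Cardinal.aleph 1).ord → ℕ → Set (Set.Iio (Cardinal.aleph 1).ord) :=
    fun b n => {a | (φ a : Ordinal) ∈ S (φ b) n}
  have hT : ∀ X : Set (Set.Iio (Cardinal.aleph 1).ord), ∃ C, IsClubIn C ∧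
      ∀ c ∈ C, ∃ n, X ∩ Set.Iio c = T c n := by
    intro X
    have hX : ∀ a, (φ a : Ordinal) ∈ (fun a => (φ a : Ordinal)) '' X ↔ a ∈ X := fun a =>
      (Subtype.val_injective.comp φ.injective).mem_set_image
    obtain ⟨C, hCsub, hCunb, hCcl, hCg⟩ := hguess ((fun a => (φ a : Ordinal)) '' X) (by
      rintro _ ⟨a, _, rfl⟩
      exact (φ a).2)
    refine ⟨{a | (φ a : Ordinal) ∈ C}, ⟨fun a => ?_, fun B hB hne b hb => ?_⟩, fun c hc => ?_⟩
    · obtain ⟨b, hbC, hab⟩ := hCunb (φ a) (φ a).2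
      refine ⟨φ.symm ⟨b, hCsub hbC⟩, by simpa using hbC, ?_⟩
      rw [← φ.le_iff_le, OrderIso.apply_symm_apply]
      exact hab
    · have hsup : sSup ((fun a => (φ a : Ordinal)) '' B) = φ b := by
        refine IsLUB.csSup_eq ⟨?_, fun u hu => ?_⟩ (hne.image _)
        · rintro _ ⟨a, ha, rfl⟩
          exact φ.monotone (hb.1 ha)
        · by_contra! hub
          have hu' : u < (Cardinal.aleph 1).ord := hub.trans (φ b).2
          refine (not_le.2 hub) ?_
          have : b ≤ φ.symm ⟨u, hu'⟩ := hb.2 fun a ha => by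
            rw [← φ.le_iff_le, OrderIso.apply_symm_apply]
            exact hu ⟨a, ha, rfl⟩
          rw [← φ.le_iff_le, OrderIso.apply_symm_apply] at this
          exact this
      change (φ b : Ordinal) ∈ C
      rw [← hsup]
      refine hCcl _ ?_ (hne.image _) (hsup ▸ (φ b).2)
      rintro _ ⟨a, ha, rfl⟩
      exact hB ha
    · obtain ⟨n, hn⟩ := hCg _ hc
      refine ⟨n, Set.ext fun a => ?_⟩
      change _ ↔ (φ a : Ordinal) ∈ S (φ c) n
      rw [← hn, Set.mem_inter_iff, Set.mem_inter_iff, hX, Set.mem_Iio, Set.mem_Iio,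
        Subtype.coe_lt_coe, φ.lt_iff_lt]
  obtain ⟨Arc, hasymm, hadj, hor, hemb⟩ := exists_orientation_embedding_halfGraph T hT
    (G.comap (Subtype.val : Set.Iio (Cardinal.aleph 1).ord → Ordinal))
  let Dstar : Digraph' Ordinal :=
    { verts := Set.Iio (Cardinal.aleph 1).ord
      Arc := fun u v => ∃ (hu : u < (Cardinal.aleph 1).ord) (hv : v < (Cardinal.aleph 1).ord),
        Arc ⟨u, hu⟩ ⟨v, hv⟩
      arc_left := fun _ _ h => h.1
      arc_right := fun _ _ h => h.2.1
      irrefl' := fun _ ⟨_, _, h⟩ => hasymm _ _ h h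
      asymm' := fun _ _ ⟨_, _, h⟩ ⟨_, _, h'⟩ => hasymm _ _ h h' }
  refine ⟨Dstar, rfl, fun u v ⟨_, _, h⟩ => hadj _ _ h, fun u v h => ?_,
    fun A hA hAchr D _ hD _ => ?_⟩
  · obtain ⟨hu, hv⟩ := hG u v h
    exact (hor ⟨u, hu⟩ ⟨v, hv⟩ h).imp (fun h => ⟨hu, hv, h⟩) fun h => ⟨hv, hu, h⟩
  · have hchrA : (G.comap (Subtype.val : Set.Iio (Cardinal.aleph 1).ord → Ordinal)
        ).UncountablyChromaticOn (Subtype.val ⁻¹' A) := by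
      rintro ⟨F, hF, hcov⟩
      refine hAchr ⟨fun n => Subtype.val '' F n, ?_, fun a ha => ?_⟩
      · rintro n _ ⟨u, hu, rfl⟩ _ ⟨v, hv, rfl⟩
        exact hF n u hu v hv
      · obtain ⟨n, hn⟩ := Set.mem_iUnion.1 (hcov (show (⟨a, hA ha⟩ : Set.Iio _) ∈ _ from ha))
        exact Set.mem_iUnion.2 ⟨n, _, hn, rfl⟩
    obtain ⟨f, hf, hfA, hfarc⟩ := hemb _ hchrA D hD
    exact ⟨fun u => f u, (Subtype.val_injective.comp hf).injOn, fun u _ => ⟨(f u).2, hfA u⟩,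
      fun u v h => ⟨⟨(f u).2, (f v).2, hfarc u v h⟩, hfA u, hfA v⟩⟩
end
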